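/- arXiv:1310.6644 — 4 statements merged into one kernel-verified Lean document; each statement's English description precedes it below -/
import Mathlib

section
/- Let (D, B_0) be a dimaze. If the linkability system M_L(D, B_0) is nearly finitary, then M_L(D, B_0) is a matroid. -/
open Set

universe u

variable {V : Type*}

/-- A directed path in the digraph `D`: a nonempty duplicate-free list of vertices
with an edge between consecutive vertices. -/
structure DiPath {V : Type*} (D : V → V → Prop) where
  verts : List V
  ne : verts ≠ []
  nodup : verts.Nodup
  chain : verts.Chain' D

namespace DiPath

variable {D : V → V → Prop}

/-- The initial vertex of a directed path. -/
def first (p : DiPath D) : V := p.verts.head p.ne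

/-- The terminal vertex of a directed path. -/
def last (p : DiPath D) : V := p.verts.getLast p.ne

/-- The set of vertices of a directed path. -/
def vertSet (p : DiPath D) : Set V := {v | v ∈ p.verts}

/-- The set of (directed) edges of a directed path. -/
def edgeSet (p : DiPath D) : Set (V × V) := {e | e ∈ p.verts.zip p.verts.tail}

end DiPath

/-- The set of initial vertices of a collection of paths. -/
def Ini {D : V → V → Prop} (P : Set (DiPath D)) : Set V := {v | ∃ p ∈ P, p.first = v}

/-- The set of terminal vertices of a collection of paths. -/
def Ter {D : V → V → Prop} (P : Set (DiPath D)) : Set V := {v | ∃ p ∈ P, p.last = v}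

/-- All vertices used by a collection of paths. -/
def LinkVerts {D : V → V → Prop} (P : Set (DiPath D)) : Set V := ⋃ p ∈ P, p.vertSet

/-- All edges used by a collection of paths. -/
def LinkEdges {D : V → V → Prop} (P : Set (DiPath D)) : Set (V × V) := ⋃ p ∈ P, p.edgeSet

/-- A linkage in the dimaze `(D, B0)`: a set of pairwise vertex-disjoint directed
paths, each ending in `B0`. -/
def IsLinkage (D : V → V → Prop) (B0 : Set V) (P : Set (DiPath D)) : Prop :=
  (∀ p ∈ P, p.last ∈ B0) ∧
  (∀ p ∈ P, ∀ q ∈ P, p ≠ q → Disjoint p.vertSet q.vertSet)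

/-- `(D, B0)` is a dimaze: every vertex of `B0` has out-degree `0`. -/
def IsDimaze (D : V → V → Prop) (B0 : Set V) : Prop := ∀ b ∈ B0, ∀ v, ¬ D b v

/-- A set of vertices is linkable if it is the set of initial vertices of a linkage. -/
def Linkable (D : V → V → Prop) (B0 : Set V) (I : Set V) : Prop :=
  ∃ P, IsLinkage D B0 P ∧ Ini P = I

/-- A set of vertices is linkable onto `B0` if it is the set of initial vertices of
a linkage whose terminal vertices are all of `B0`. -/
def LinkableOnto (D : V → V → Prop) (B0 : Set V) (I : Set V) : Prop :=
  ∃ P, IsLinkage D B0 P ∧ Ini P = I ∧ Ter P = B0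

/-- `I` is a maximal element (w.r.t. inclusion) of the set system `Ind`. -/
def MaximalIn {α : Type*} (Ind : Set α → Prop) (I : Set α) : Prop :=
  Ind I ∧ ∀ J, Ind J → I ⊆ J → J = I

/-- The maximality axiom (IM). -/
def SatisfiesIM {α : Type*} (Ind : Set α → Prop) : Prop :=
  ∀ I X : Set α, Ind I → I ⊆ X →
    ∃ J, Ind J ∧ I ⊆ J ∧ J ⊆ X ∧ ∀ K, Ind K → K ⊆ X → J ⊆ K → K = J

/-- `Ind` is the collection of independent sets of a matroid:
axioms (I1), (I2), (I3) and (IM). -/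
def IsMatroidIndep {α : Type*} (Ind : Set α → Prop) : Prop :=
  Ind ∅ ∧
  (∀ I J : Set α, I ⊆ J → Ind J → Ind I) ∧
  (∀ I B : Set α, Ind I → ¬ MaximalIn Ind I → MaximalIn Ind B →
    ∃ x ∈ B \ I, Ind (insert x I)) ∧
  SatisfiesIM Ind

/-- The dimaze `(D, B0)` contains an alternating comb: there is an alternating ray
(given by the injective vertex sequence `f` and edge orientations `o`, with
infinitely many vertices of in-degree 2) together with a linkage of all its
in-degree-2 vertices and its first vertex onto a set of exits contained in `B0`,
by disjoint paths meeting the ray exactly at their initial vertices. -/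
def ContainsAltComb (D : V → V → Prop) (B0 : Set V) : Prop :=
  ∃ (f : ℕ → V) (o : ℕ → Bool) (P : Set (DiPath D)),
    Function.Injective f ∧
    (∀ n, if o n then D (f n) (f (n+1)) else D (f (n+1)) (f n)) ∧
    (∀ N, ∃ k ≥ N, o k = true ∧ o (k+1) = false) ∧
    IsLinkage D B0 P ∧
    Ini P = insert (f 0) {v | ∃ k, o k = true ∧ o (k+1) = false ∧ v = f (k+1)} ∧
    (∀ p ∈ P, ∀ v ∈ p.vertSet, v ∈ Set.range f → v = p.first)
/-- The finitarisation of a set system: sets all of whose finite subsets are independent. -/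
def Finitarisation {α : Type*} (Ind : Set α → Prop) (I : Set α) : Prop :=
  ∀ J ⊆ I, J.Finite → Ind J

/-- A set system is nearly finitary if every maximal element of its finitarisation
has an independent subset with finite complement in it. -/
def NearlyFinitary {α : Type*} (Ind : Set α → Prop) : Prop :=
  ∀ B, MaximalIn (Finitarisation Ind) B → ∃ I, Ind I ∧ (B \ I).Finite

open Relation in
structure Lk (D : V → V → Prop) (B0 : Set V) (E : V → V → Prop) (I : Set V) : Prop where
  le : ∀ u v, E u v → D u v
  fn : ∀ u v w, E u v → E u w → v = w
  cofn : ∀ u v w, E u w → E v w → u = v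
  ini : ∀ u, ∀ v ∈ I, ¬ E u v
  reach : ∀ v ∈ I, ∃ b ∈ B0, ReflTransGen E v b

section aux
open Relation

variable {D : V → V → Prop} {B0 : Set V}

theorem Lk.uniq {E : V → V → Prop} {I : Set V} (h : Lk D B0 E I) {i j v : V} (hi : i ∈ I)
    (hj : j ∈ I) (h1 : ReflTransGen E i v) (h2 : ReflTransGen E j v) : i = j := by
  have h1' := reflTransGen_swap.2 h1
  have h2' := reflTransGen_swap.2 h2
  have hU : Relator.RightUnique (Function.swap E) := fun a b c hb hc => h.cofn _ _ _ hb hc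
  rcases ReflTransGen.total_of_right_unique hU h1' h2' with h3 | h3
  · rcases ReflTransGen.cases_head h3 with h4 | ⟨c, h4, _⟩
    · exact h4
    · exact absurd h4 (h.ini _ _ hi)
  · rcases ReflTransGen.cases_head h3 with h4 | ⟨c, h4, _⟩
    · exact h4.symm
    · exact absurd h4 (h.ini _ _ hj)

theorem Lk.path {E : V → V → Prop} {I : Set V} (h : Lk D B0 E I) {i : V} (hi : i ∈ I) :
    ∃ p : DiPath D, p.first = i ∧ p.last ∈ B0 ∧ ∀ v ∈ p.verts, ReflTransGen E i v := by
  obtain ⟨b, hb, hr⟩ := h.reach i hi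
  obtain ⟨l, hl, hc, hh, hlast⟩ := List.exists_isChain_ne_nil_of_relationReflTransGen hr
  have hE : ∀ (n : ℕ) (hn : n + 1 < l.length), E l[n] l[n+1] := by
    intro n hn
    exact List.isChain_iff_getElem.1 hc n hn
  have h0 : ∀ h0 : 0 < l.length, l[0] = i := by
    intro h0; rw [← hh, List.head_eq_getElem]
  have key : ∀ (m n : ℕ) (hm : m < l.length) (hn : n < l.length), m < n → l[m] ≠ l[n] := by
    intro m
    induction m with
    | zero =>
      intro n hm hn hmn he
      obtain ⟨k, rfl⟩ : ∃ k, n = k + 1 := ⟨n - 1, by omega⟩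
      have := hE k hn
      rw [← he, h0] at this
      exact h.ini _ _ hi this
    | succ m ih =>
      intro n hm hn hmn he
      obtain ⟨k, rfl⟩ : ∃ k, n = k + 1 := ⟨n - 1, by omega⟩
      have h1 := hE k hn
      have h2 := hE m hm
      rw [← he] at h1
      exact ih k (by omega) (by omega) (by omega) (h.cofn _ _ _ h2 h1)
  refine ⟨⟨l, hl, ?_, ?_⟩, hh, ?_, ?_⟩
  · rw [List.nodup_iff_injective_get]
    intro a b hab
    by_contra hne
    rcases lt_or_gt_of_ne (fun h => hne (Fin.ext h) : a.1 ≠ b.1) with h1 | h1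
    · exact key _ _ a.2 b.2 h1 hab
    · exact key _ _ b.2 a.2 h1 hab.symm
  · exact hc.imp (fun a b hab => h.le _ _ hab)
  · show l.getLast hl ∈ B0
    rwa [hlast]
  · have : ∀ (n : ℕ) (hn : n < l.length), ReflTransGen E i l[n] := by
      intro n
      induction n with
      | zero => intro hn; rw [h0]
      | succ n ih => intro hn; exact (ih (by omega)).tail (hE n hn)
    intro v hv
    obtain ⟨n, hn, rfl⟩ := List.getElem_of_mem hv
    exact this n hn

theorem Lk.linkable {E : V → V → Prop} {I : Set V} (h : Lk D B0 E I) : Linkable D B0 I := by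
  choose f h1 h2 h3 using fun (i : I) => h.path i.2
  refine ⟨Set.range f, ⟨?_, ?_⟩, ?_⟩
  · rintro _ ⟨i, rfl⟩; exact h2 i
  · rintro _ ⟨i, rfl⟩ _ ⟨j, rfl⟩ hne
    rw [Set.disjoint_left]
    intro v hv hw
    exact hne (congrArg f (Subtype.ext (h.uniq i.2 j.2 (h3 i v hv) (h3 j v hw))))
  · ext v
    constructor
    · rintro ⟨_, ⟨i, rfl⟩, rfl⟩; rw [h1 i]; exact i.2
    · intro hv; exact ⟨f ⟨v, hv⟩, ⟨⟨v, hv⟩, rfl⟩, h1 ⟨v, hv⟩⟩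

theorem Linkable.lk {I : Set V} (h : Linkable D B0 I) : ∃ E, Lk D B0 E I := by
  obtain ⟨P, ⟨hB, hdis⟩, rfl⟩ := h
  have same : ∀ p ∈ P, ∀ q ∈ P, ∀ v, v ∈ p.verts → v ∈ q.verts → p = q := by
    intro p hp q hq v hv hw
    by_contra hne
    exact Set.disjoint_left.1 (hdis p hp q hq hne) hv hw
  refine ⟨fun u v => ∃ p ∈ P, ∃ (n : ℕ) (hn : n + 1 < p.verts.length),
    p.verts[n] = u ∧ p.verts[n+1] = v, ?_, ?_, ?_, ?_, ?_⟩
  · rintro _ _ ⟨p, hp, n, hn, rfl, rfl⟩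
    exact List.isChain_iff_getElem.1 p.chain n hn
  · rintro _ _ _ ⟨p, hp, n, hn, rfl, rfl⟩ ⟨q, hq, m, hm, h1, rfl⟩
    obtain rfl := same p hp q hq _ (List.getElem_mem (by omega)) (h1 ▸ List.getElem_mem (by omega))
    have := (p.nodup.getElem_inj_iff).1 h1
    subst this; rfl
  · rintro _ _ _ ⟨p, hp, n, hn, rfl, rfl⟩ ⟨q, hq, m, hm, rfl, h1⟩
    obtain rfl := same p hp q hq _ (List.getElem_mem hn) (h1 ▸ List.getElem_mem (by omega))
    have := (p.nodup.getElem_inj_iff).1 h1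
    obtain rfl : m = n := by omega
    rfl
  · rintro _ _ ⟨q, hq, rfl⟩ ⟨p, hp, n, hn, rfl, h1⟩
    have h2 : q.first = q.verts[0]'(List.length_pos_iff.2 q.ne) := List.head_eq_getElem _
    obtain rfl := same p hp q hq _ (List.getElem_mem hn) (h1 ▸ List.head_mem _)
    rw [h2] at h1
    have := (p.nodup.getElem_inj_iff).1 h1
    omega
  · rintro _ ⟨p, hp, rfl⟩
    refine ⟨p.last, hB p hp, ?_⟩
    refine List.relationReflTransGen_of_exists_isChain p.verts ?_ p.ne
    rw [List.isChain_iff_getElem]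
    intro n hn
    exact ⟨p, hp, n, hn, rfl, rfl⟩

theorem Lk.mono {E : V → V → Prop} {I J : Set V} (h : Lk D B0 E J) (hIJ : I ⊆ J) :
    Lk D B0 E I :=
  ⟨h.le, h.fn, h.cofn, fun u v hv => h.ini u v (hIJ hv), fun v hv => h.reach v (hIJ hv)⟩

theorem Linkable.mono' {I J : Set V} (h : Linkable D B0 J) (hIJ : I ⊆ J) : Linkable D B0 I := by
  obtain ⟨E, hE⟩ := h.lk
  exact (hE.mono hIJ).linkable

/-- vertices on the paths -/
def VOn (P : V → V → Prop) (A : Set V) : Set V := {v | ∃ a ∈ A, ReflTransGen P a v}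

/-- restricted relation -/
def QF (Q : V → V → Prop) (F : Set V) : V → V → Prop := fun u v => Q u v ∧ u ∈ F ∧ v ∈ F

def Good (P Q : V → V → Prop) (A B F : Set V) : Prop :=
  ∀ v ∈ F, v ∈ B ∨ ∃ u ∈ F, Q u v ∧ (u ∈ VOn P A → ∃ w ∈ F, TransGen P u w)

def ExitPt (B0 : Set V) (P : V → V → Prop) (A F : Set V) (x : V) : Prop :=
  x ∈ F ∧ ((x ∈ VOn P A ∧ ∀ w ∈ F, ¬ TransGen P x w) ∨ (x ∉ VOn P A ∧ x ∈ B0))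

def KeepA (P : V → V → Prop) (A F : Set V) : Set V := {a ∈ A | ∀ w ∈ F, ¬ ReflTransGen P a w}

def NewB (B0 : Set V) (P Q : V → V → Prop) (A B F : Set V) : Set V :=
  {b ∈ B | b ∈ F ∧ ∃ x, ReflTransGen (QF Q F) b x ∧ ExitPt B0 P A F x}

theorem VOn.reach {P : V → V → Prop} {A : Set V} (hP : Lk D B0 P A) (hD : IsDimaze D B0) {v : V}
    (hv : v ∈ VOn P A) : ∃ b ∈ B0, ReflTransGen P v b := by
  obtain ⟨a, ha, hav⟩ := hv
  obtain ⟨b, hb, hab⟩ := hP.reach a ha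
  have hU : Relator.RightUnique P := fun a b c hb hc => hP.fn _ _ _ hb hc
  refine ⟨b, hb, ?_⟩
  rcases ReflTransGen.total_of_right_unique hU hav hab with h | h
  · exact h
  · rcases ReflTransGen.cases_head h with h4 | ⟨c, h4, _⟩
    · rw [h4]
    · exact absurd (hP.le _ _ h4) (hD b hb c)

theorem Good.f2 {P Q : V → V → Prop} {A B F : Set V} (hQ : Lk D B0 Q B) (hF : Good P Q A B F)
    {u v : V} (hv : v ∈ F) (huv : Q u v) (hu : u ∈ VOn P A) : ∃ w ∈ F, TransGen P u w := by
  rcases hF v hv with h | ⟨u', hu', h1, h2⟩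
  · exact absurd huv (hQ.ini _ _ h)
  · obtain rfl := hQ.cofn _ _ _ huv h1
    exact h2 hu

theorem newLk {P Q : V → V → Prop} {A B F : Set V} (hD : IsDimaze D B0)
    (hP : Lk D B0 P A) (hQ : Lk D B0 Q B) (hF : Good P Q A B F) :
    Linkable D B0 (KeepA P A F ∪ NewB B0 P Q A B F) := by
  let E : V → V → Prop := fun u v => QF Q F u v ∨
    (P u v ∧ u ∈ VOn P A ∧ ∀ w ∈ F, ¬ ReflTransGen P v w)
  have mix : ∀ u v v', QF Q F u v → P u v' → u ∈ VOn P A → (∀ w ∈ F, ¬ ReflTransGen P v' w) →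
      False := by
    intro u v v' h1 h2 h3 h4
    obtain ⟨w, hw, hw'⟩ := hF.f2 hQ h1.2.2 h1.1 h3
    obtain ⟨c, hc, hc'⟩ := TransGen.head'_iff.1 hw'
    obtain rfl := hP.fn _ _ _ hc h2
    exact h4 w hw hc'
  have follow : ∀ x b, ReflTransGen P x b → x ∈ VOn P A → (∀ w ∈ F, ¬ TransGen P x w) →
      ReflTransGen E x b := by
    intro x b hxb
    induction hxb using ReflTransGen.head_induction_on with
    | refl => intros; rfl
    | @head x y hxy hyb ih =>
      intro hx hw
      refine ReflTransGen.head (b := y) (Or.inr ⟨hxy, hx, fun w hwF hyw =>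
        hw w hwF (TransGen.head' hxy hyw)⟩) (ih ?_ fun w hwF hyw => hw w hwF (TransGen.head hxy hyw))
      obtain ⟨a, ha, hax⟩ := hx
      exact ⟨a, ha, hax.tail hxy⟩
  have L : Lk D B0 E (KeepA P A F ∪ NewB B0 P Q A B F) := by
    refine ⟨?_, ?_, ?_, ?_, ?_⟩
    · rintro u v (h | h)
      · exact hQ.le _ _ h.1
      · exact hP.le _ _ h.1
    · rintro u v w (h | h) (h' | h')
      · exact hQ.fn _ _ _ h.1 h'.1
      · exact (mix _ _ _ h h'.1 h'.2.1 h'.2.2).elim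
      · exact (mix _ _ _ h' h.1 h.2.1 h.2.2).elim
      · exact hP.fn _ _ _ h.1 h'.1
    · rintro u v w (h | h) (h' | h')
      · exact hQ.cofn _ _ _ h.1 h'.1
      · exact (h'.2.2 _ h.2.2 .refl).elim
      · exact (h.2.2 _ h'.2.2 .refl).elim
      · exact hP.cofn _ _ _ h.1 h'.1
    · rintro u v (hv | hv) (h | h)
      · exact hv.2 _ h.2.2 .refl
      · exact hP.ini _ _ hv.1 h.1
      · exact hQ.ini _ _ hv.1 h.1
      · exact h.2.2 _ hv.2.1 .refl
    · rintro v (hv | ⟨hv, hvF, x, hvx, hxF, hx⟩)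
      · obtain ⟨b, hb, hr⟩ := hP.reach v hv.1
        exact ⟨b, hb, follow v b hr ⟨v, hv.1, .refl⟩ fun w hw h => hv.2 w hw h.to_reflTransGen⟩
      · have h1 : ReflTransGen E v x := ReflTransGen.mono (fun _ _ h => Or.inl h) _ _ hvx
        rcases hx with ⟨hx, hw⟩ | ⟨_, hx⟩
        · obtain ⟨b, hb, hr⟩ := VOn.reach hP hD hx
          exact ⟨b, hb, h1.trans (follow x b hr hx hw)⟩
        · exact ⟨x, hx, h1⟩
  exact L.linkable

inductive Rch (P Q : V → V → Prop) (A B : Set V) : V → Prop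
  | base (v : V) : v ∈ B → Rch P Q A B v
  | free (u v : V) : Rch P Q A B u → Q u v → u ∉ VOn P A → Rch P Q A B v
  | push (u v w : V) : Rch P Q A B u → Q u v → Rch P Q A B w → TransGen P u w → Rch P Q A B v

theorem Rch.good (P Q : V → V → Prop) (A B : Set V) : Good P Q A B {v | Rch P Q A B v} := by
  intro v hv
  cases hv with
  | base _ h => exact Or.inl h
  | free u _ h1 h2 h3 => exact Or.inr ⟨u, h1, h2, fun h => absurd h h3⟩
  | push u _ w h1 h2 h3 h4 => exact Or.inr ⟨u, h1, h2, fun _ => ⟨w, h3, h4⟩⟩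

theorem Rch.on {P Q : V → V → Prop} {A B : Set V} {v : V} (h : Rch P Q A B v) : v ∈ VOn Q B := by
  induction h with
  | base v h => exact ⟨v, h, .refl⟩
  | free u v h1 h2 h3 ih => obtain ⟨a, ha, hu⟩ := ih; exact ⟨a, ha, hu.tail h2⟩
  | push u v w h1 h2 h3 h4 ih _ => obtain ⟨a, ha, hu⟩ := ih; exact ⟨a, ha, hu.tail h2⟩

theorem Good.union {P Q : V → V → Prop} {A B F G : Set V} (hF : Good P Q A B F)
    (hG : Good P Q A B G) : Good P Q A B (F ∪ G) := by
  rintro v (h | h)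
  · rcases hF v h with h | ⟨u, h1, h2, h3⟩
    · exact Or.inl h
    · exact Or.inr ⟨u, Or.inl h1, h2, fun h => (h3 h).imp fun w hw => ⟨Or.inl hw.1, hw.2⟩⟩
  · rcases hG v h with h | ⟨u, h1, h2, h3⟩
    · exact Or.inl h
    · exact Or.inr ⟨u, Or.inr h1, h2, fun h => (h3 h).imp fun w hw => ⟨Or.inr hw.1, hw.2⟩⟩

theorem Good.ins {P Q : V → V → Prop} {A B F : Set V} (hF : Good P Q A B F) {v : V}
    (hv : v ∈ B ∨ ∃ u ∈ F, Q u v ∧ (u ∈ VOn P A → ∃ w ∈ F, TransGen P u w)) :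
    Good P Q A B (insert v F) := by
  have up : ∀ x, (x ∈ B ∨ ∃ u ∈ F, Q u x ∧ (u ∈ VOn P A → ∃ w ∈ F, TransGen P u w)) →
     (x ∈ B ∨ ∃ u ∈ insert v F, Q u x ∧ (u ∈ VOn P A → ∃ w ∈ insert v F, TransGen P u w)) := by
    rintro x (h | ⟨u, h1, h2, h3⟩)
    · exact Or.inl h
    · exact Or.inr ⟨u, Or.inr h1, h2, fun h => (h3 h).imp fun w hw => ⟨Or.inr hw.1, hw.2⟩⟩
  rintro x (rfl | hx)
  · exact up _ hv
  · exact up _ (hF x hx)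

theorem Rch.finite {P Q : V → V → Prop} {A B : Set V} {v : V} (h : Rch P Q A B v) :
    ∃ F : Set V, F.Finite ∧ v ∈ F ∧ F ⊆ {v | Rch P Q A B v} ∧ Good P Q A B F := by
  induction h with
  | base v h =>
    exact ⟨{v}, Set.finite_singleton v, rfl, by rintro _ rfl; exact Rch.base _ h,
      by rintro _ rfl; exact Or.inl h⟩
  | free u v h1 h2 h3 ih =>
    obtain ⟨F, hf, huF, hsub, hg⟩ := ih
    exact ⟨insert v F, hf.insert v, Or.inl rfl, Set.insert_subset (Rch.free u v h1 h2 h3) hsub,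
      hg.ins (Or.inr ⟨u, huF, h2, fun h => absurd h h3⟩)⟩
  | push u v w h1 h2 h3 h4 ih ih' =>
    obtain ⟨F, hf, huF, hsub, hg⟩ := ih
    obtain ⟨G, hf', huF', hsub', hg'⟩ := ih'
    exact ⟨insert v (F ∪ G), (hf.union hf').insert v, Or.inl rfl,
      Set.insert_subset (Rch.push u v w h1 h2 h3 h4) (Set.union_subset hsub hsub'),
      (hg.union hg').ins (Or.inr ⟨u, Or.inl huF, h2, fun _ => ⟨w, Or.inr huF', h4⟩⟩)⟩

theorem Rch.newB {P Q : V → V → Prop} {A B : Set V} (hD : IsDimaze D B0)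
    (hP : Lk D B0 P A) (hQ : Lk D B0 Q B) :
    NewB B0 P Q A B {v | Rch P Q A B v} = B := by
  ext b
  refine ⟨fun h => h.1, fun hb => ⟨hb, Rch.base b hb, ?_⟩⟩
  obtain ⟨b0, hb0, hr⟩ := hQ.reach b hb
  have hbR := Rch.base (P := P) (Q := Q) (A := A) b hb
  clear hb
  induction hr using ReflTransGen.head_induction_on with
  | refl =>
    refine ⟨b0, .refl, hbR, ?_⟩
    by_cases h : b0 ∈ VOn P A
    · refine Or.inl ⟨h, fun w _ hw => ?_⟩
      obtain ⟨c, hc, _⟩ := TransGen.head'_iff.1 hw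
      exact hD b0 hb0 c (hP.le _ _ hc)
    · exact Or.inr ⟨h, hb0⟩
  | @head v y hvy _ ih =>
    have go : Rch P Q A B y → ∃ x, ReflTransGen (QF Q {v | Rch P Q A B v}) v x ∧
        ExitPt B0 P A {v | Rch P Q A B v} x := by
      intro hy
      obtain ⟨x, hx, hx'⟩ := ih hy
      exact ⟨x, ReflTransGen.head ⟨hvy, hbR, hy⟩ hx, hx'⟩
    by_cases h : v ∈ VOn P A
    · by_cases h' : ∃ w, Rch P Q A B w ∧ TransGen P v w
      · obtain ⟨w, hw, hw'⟩ := h'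
        exact go (Rch.push v y w hbR hvy hw hw')
      · exact ⟨v, .refl, hbR, Or.inl ⟨h, fun w hw hw' => h' ⟨w, hw, hw'⟩⟩⟩
    · exact go (Rch.free v y hbR hvy h)

theorem Good.qf {P Q : V → V → Prop} {A B F : Set V} (hQ : Lk D B0 Q B) (hF : Good P Q A B F)
    {b x : V} (hbx : ReflTransGen Q b x) (hx : x ∈ F) : b ∈ F ∧ ReflTransGen (QF Q F) b x := by
  induction hbx with
  | refl => exact ⟨hx, .refl⟩
  | @tail y z hy hyz ih =>
    rcases hF z hx with h | ⟨u, hu, h1, _⟩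
    · exact absurd hyz (hQ.ini _ _ h)
    · obtain rfl := hQ.cofn _ _ _ hyz h1
      exact ⟨(ih hu).1, (ih hu).2.tail ⟨hyz, hu, hx⟩⟩

theorem exists_lastF {P : V → V → Prop} {A F : Set V} (hD : IsDimaze D B0) (hP : Lk D B0 P A)
    {a : V} (ha : a ∈ VOn P A) (hw : ∃ w ∈ F, ReflTransGen P a w) :
    ∃ x ∈ F, ReflTransGen P a x ∧ ∀ w ∈ F, ¬ TransGen P x w := by
  obtain ⟨b, hb, hr⟩ := VOn.reach hP hD ha
  clear ha
  induction hr using ReflTransGen.head_induction_on with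
  | refl =>
    have hno : ∀ w, ¬ TransGen P b w := by
      intro w hw
      obtain ⟨c, hc, _⟩ := TransGen.head'_iff.1 hw
      exact hD b hb c (hP.le _ _ hc)
    obtain ⟨w, hw, hbw⟩ := hw
    rcases ReflTransGen.cases_head hbw with rfl | ⟨c, hc, _⟩
    · exact ⟨b, hw, .refl, fun w _ => hno w⟩
    · exact absurd (TransGen.single hc) (hno c)
  | @head v y hvy _ ih =>
    by_cases h : ∃ w ∈ F, ReflTransGen P y w
    · obtain ⟨x, hx, hyx, hx'⟩ := ih h
      exact ⟨x, hx, ReflTransGen.head hvy hyx, hx'⟩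
    · have hno : ∀ w ∈ F, ¬ TransGen P v w := by
        intro w hwF hw
        obtain ⟨c, hc, hcw⟩ := TransGen.head'_iff.1 hw
        obtain rfl := hP.fn _ _ _ hc hvy
        exact h ⟨w, hwF, hcw⟩
      obtain ⟨w, hw, hbw⟩ := hw
      rcases ReflTransGen.cases_head hbw with rfl | ⟨c, hc, hcw⟩
      · exact ⟨v, hw, .refl, hno⟩
      · exact absurd (TransGen.head' hc hcw) (hno w hw)

theorem lemU {A B : Set V} (hD : IsDimaze D B0) (hA : Linkable D B0 A) (hB : Linkable D B0 B) :
    ∃ S ⊆ A, Linkable D B0 (B ∪ S) ∧ ∀ z ∈ A, z ∉ B → z ∉ S →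
      ∃ J, Linkable D B0 J ∧ J ⊆ A ∪ B ∧ z ∉ J ∧ (A \ J).Finite ∧ (J \ A).Finite ∧
        (A \ J).ncard ≤ (J \ A).ncard := by
  obtain ⟨P, hP⟩ := hA.lk
  obtain ⟨Q, hQ⟩ := hB.lk
  refine ⟨KeepA P A {v | Rch P Q A B v}, fun a ha => ha.1, ?_, ?_⟩
  · have := newLk hD hP hQ (Rch.good P Q A B)
    rwa [Rch.newB hD hP hQ, Set.union_comm] at this
  intro z hzA hzB hzS
  have : ∃ w, Rch P Q A B w ∧ ReflTransGen P z w := by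
    by_contra hcon
    exact hzS ⟨hzA, fun w hw hzw => hcon ⟨w, hw, hzw⟩⟩
  obtain ⟨w, hw, hzw⟩ := this
  obtain ⟨F, hfin, hwF, hsub, hg⟩ := hw.finite
  set X : Set V := {a ∈ A | ∃ w ∈ F, ReflTransGen P a w} with hX
  set W : Set V := NewB B0 P Q A B F with hW
  have hWfin : W.Finite := hfin.subset fun b hb => hb.2.1
  have hex : ∀ a ∈ X, ∃ b ∈ W, ∃ x, ReflTransGen (QF Q F) b x ∧ ReflTransGen P a x ∧
      x ∈ VOn P A ∧ ∀ w ∈ F, ¬ TransGen P x w := by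
    rintro a ⟨haA, haw⟩
    obtain ⟨x, hxF, hax, hx⟩ := exists_lastF hD hP ⟨a, haA, .refl⟩ haw
    obtain ⟨b, hb, hbx⟩ := (hsub hxF).on
    obtain ⟨hbF, hbx'⟩ := hg.qf hQ hbx hxF
    exact ⟨b, ⟨hb, hbF, x, hbx', hxF, Or.inl ⟨⟨a, haA, hax⟩, hx⟩⟩, x, hbx', hax, ⟨a, haA, hax⟩, hx⟩
  choose! f hfW g hg1 hg2 hg3 hg4 using hex
  have hU : Relator.RightUnique (QF Q F) := fun a b c hb hc => hQ.fn _ _ _ hb.1 hc.1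
  have hstep : ∀ a ∈ X, ∀ y, ¬ QF Q F (g a) y := by
    intro a ha y hy
    obtain ⟨w, hw, hw'⟩ := hg.f2 hQ hy.2.2 hy.1 (hg3 a ha)
    exact hg4 a ha w hw hw'
  have hinj : Set.InjOn f X := by
    intro a ha a' ha' he
    have h1 := hg1 a ha
    have h2 := hg1 a' ha'
    rw [he] at h1
    have : g a = g a' := by
      rcases ReflTransGen.total_of_right_unique hU h1 h2 with h | h
      · rcases ReflTransGen.cases_head h with h | ⟨c, h, _⟩
        · exact h
        · exact absurd h (hstep a ha c)
      · rcases ReflTransGen.cases_head h with h | ⟨c, h, _⟩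
        · exact h.symm
        · exact absurd h (hstep a' ha' c)
    refine hP.uniq ha.1 ha'.1 (hg2 a ha) ?_
    rw [this]; exact hg2 a' ha'
  have hmap : Set.MapsTo f X W := hfW
  have hXfin : X.Finite := Set.Finite.of_injOn hmap hinj hWfin
  have hcard : X.ncard ≤ W.ncard := Set.ncard_le_ncard_of_injOn f hfW hinj hWfin
  have hWA : W ∩ A ⊆ X := fun b hb => ⟨hb.2, b, hb.1.2.1, .refl⟩
  have hKX : KeepA P A F = A \ X := by
    ext a
    constructor
    · rintro ⟨h1, h2⟩
      exact ⟨h1, fun h => by obtain ⟨_, w, hw, hw'⟩ := h; exact h2 w hw hw'⟩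
    · rintro ⟨h1, h2⟩
      exact ⟨h1, fun w hw hw' => h2 ⟨h1, w, hw, hw'⟩⟩
  have hJ := newLk hD hP hQ hg
  rw [hKX, ← hW] at hJ
  have hWB : W ⊆ B := fun b hb => hb.1
  have hzX : z ∈ X := ⟨hzA, w, hwF, hzw⟩
  have e1 : A \ (A \ X ∪ W) ⊆ X \ W := by
    intro a ⟨h1, h2⟩
    by_cases h : a ∈ X
    · exact ⟨h, fun h' => h2 (Or.inr h')⟩
    · exact absurd (Or.inl ⟨h1, h⟩) h2
  have e2 : (A \ X ∪ W) \ A ⊆ W := by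
    rintro a ⟨h1 | h1, h2⟩
    · exact absurd h1.1 h2
    · exact h1
  have e3 : W \ X ⊆ (A \ X ∪ W) \ A := fun a ha => ⟨Or.inr ha.1, fun h => ha.2 (hWA ⟨ha.1, h⟩)⟩
  refine ⟨A \ X ∪ W, hJ, ?_, ?_, hXfin.subset (e1.trans fun a ha => ha.1), hWfin.subset e2, ?_⟩
  · rintro a (h | h)
    · exact Or.inl h.1
    · exact Or.inr (hWB h)
  · rintro (h | h)
    · exact h.2 hzX
    · exact hzB (hWB h)
  · have f1 := Set.ncard_le_ncard e1 (hXfin.subset fun a ha => ha.1)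
    have f2 := Set.ncard_le_ncard e3 (hWfin.subset e2)
    have f3 := Set.ncard_inter_add_ncard_sdiff_eq_ncard X W hXfin
    have f4 := Set.ncard_inter_add_ncard_sdiff_eq_ncard W X hWfin
    rw [Set.inter_comm] at f4
    omega

theorem lemE {I A : Set V} {w : V} (hD : IsDimaze D B0) (hI : Linkable D B0 (insert w I))
    (hA : Linkable D B0 A) (hIA : I ⊆ A) (hw : w ∉ A) :
    ∃ J, Linkable D B0 J ∧ insert w I ⊆ J ∧ J ⊆ insert w A ∧ (A \ J).encard ≤ 1 := by
  obtain ⟨S, hSA, hS, hz⟩ := lemU hD hA hI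
  by_cases hall : ∀ z ∈ A, z ∉ insert w I → z ∈ S
  · refine ⟨insert w I ∪ S, hS, Set.subset_union_left, ?_, ?_⟩
    · exact Set.union_subset (Set.insert_subset_insert hIA) (hSA.trans (Set.subset_insert _ _))
    · have : A \ (insert w I ∪ S) = ∅ := by
        ext z
        simp only [Set.mem_sdiff, Set.mem_union, Set.mem_empty_iff_false, iff_false]
        rintro ⟨h1, h2⟩
        by_cases h : z ∈ insert w I
        · exact h2 (Or.inl h)
        · exact h2 (Or.inr (hall z h1 h))
      rw [this]; simp
  · push Not at hall
    obtain ⟨z, hzA, hzI, hzS⟩ := hall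
    obtain ⟨J, hJ, hJs, hzJ, hf1, hf2, hc⟩ := hz z hzA hzI hzS
    have hsub : J \ A ⊆ {w} := by
      rintro x ⟨h1, h2⟩
      rcases hJs h1 with h | h | h
      · exact absurd h h2
      · exact h
      · exact absurd (hIA h) h2
    have h1 : (J \ A).ncard ≤ 1 := by
      simpa using Set.ncard_le_ncard hsub
    have h2 : 0 < (A \ J).ncard := (Set.ncard_pos hf1).2 ⟨z, hzA, hzJ⟩
    have hwJ : w ∈ J := by
      obtain ⟨x, hx⟩ := (Set.ncard_pos hf2).1 (by omega)
      have := hsub hx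
      rw [Set.mem_singleton_iff] at this
      exact this ▸ hx.1
    have h3 : (A \ J).ncard = 1 := by omega
    obtain ⟨z', hz'⟩ := Set.ncard_eq_one.1 h3
    have hzz : z = z' := by
      have : z ∈ A \ J := ⟨hzA, hzJ⟩
      rw [hz'] at this; exact this
    subst hzz
    refine ⟨J, hJ, Set.insert_subset hwJ ?_, ?_, ?_⟩
    · intro x hx
      by_contra hxJ
      have : x ∈ A \ J := ⟨hIA hx, hxJ⟩
      rw [hz'] at this
      obtain rfl : x = z := this
      exact hzI (Or.inr hx)
    · intro x hx
      by_cases h : x ∈ A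
      · exact Or.inr h
      · exact Or.inl (hsub ⟨hx, h⟩)
    · rw [hz']; simp

theorem lemA' {K I' : Set V} (hD : IsDimaze D B0) (hI' : Linkable D B0 I') (hK : K ⊆ I')
    {T : Set V} (hT : T.Finite) : Linkable D B0 (K ∪ T) →
    ∃ J, Linkable D B0 J ∧ K ∪ T ⊆ J ∧ J ⊆ I' ∪ T ∧ (I' \ J).encard ≤ T.encard := by
  induction T, hT using Set.Finite.induction_on with
  | empty => intro h; exact ⟨I', hI', by simpa using hK, by simp, by simp⟩
  | @insert w T hw hT ih =>
    intro h
    have e : K ∪ insert w T = insert w (K ∪ T) := Set.union_insert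
    rw [e] at h ⊢
    obtain ⟨J, hJ, h1, h2, h3⟩ := ih (h.mono' (Set.subset_insert _ _))
    by_cases hwJ : w ∈ J
    · exact ⟨J, hJ, Set.insert_subset hwJ h1, h2.trans (Set.union_subset_union_right _
        (Set.subset_insert _ _)), h3.trans (Set.encard_le_encard (Set.subset_insert _ _))⟩
    · obtain ⟨J', hJ', k1, k2, k3⟩ := lemE hD h hJ h1 hwJ
      refine ⟨J', hJ', k1, ?_, ?_⟩
      · rw [Set.union_insert]
        exact k2.trans (Set.insert_subset_insert h2)
      · rw [Set.encard_insert_of_notMem hw]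
        have : I' \ J' ⊆ (I' \ J) ∪ (J \ J') := by
          intro x hx
          by_cases h : x ∈ J
          · exact Or.inr ⟨h, hx.2⟩
          · exact Or.inl ⟨hx.1, h⟩
        exact (Set.encard_le_encard this).trans ((Set.encard_union_le _ _).trans (add_le_add h3 k3))

theorem lemA {I I' : Set V} (hD : IsDimaze D B0) (hI : Linkable D B0 I) (hI' : Linkable D B0 I')
    (hf : (I \ I').Finite) :
    ∃ J, Linkable D B0 J ∧ I ⊆ J ∧ J ⊆ I ∪ I' ∧ (I' \ J).encard ≤ (I \ I').encard := by
  have e : I ∩ I' ∪ I \ I' = I := Set.inter_union_sdiff I I'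
  obtain ⟨J, hJ, h1, h2, h3⟩ := lemA' hD hI' (Set.inter_subset_right (s := I)) hf (by rwa [e])
  rw [e] at h1
  exact ⟨J, hJ, h1, h2.trans (by intro x hx; rcases hx with h | h; exacts [Or.inr h, Or.inl h.1]), h3⟩

theorem lemAug {I J : Set V} (hD : IsDimaze D B0) (hI : Linkable D B0 I) (hJ : Linkable D B0 J)
    (hf : (I \ J).Finite) (hc : (I \ J).encard < (J \ I).encard) :
    ∃ y ∈ J \ I, Linkable D B0 (insert y I) := by
  obtain ⟨K, hK, h1, h2, h3⟩ := lemA hD hI hJ hf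
  by_contra hcon
  push Not at hcon
  have : J \ I ⊆ J \ K := by
    intro y hy
    exact ⟨hy.1, fun hyK => hcon y hy (hK.mono' (Set.insert_subset hyK h1))⟩
  exact absurd (hc.trans_le (Set.encard_le_encard this)) (not_lt.2 h3)

theorem linkable_empty : Linkable D B0 ∅ :=
  ⟨∅, ⟨by simp, by simp⟩, by simp [Ini]⟩

theorem lemI3 {I B : Set V} (hD : IsDimaze D B0) (hI : Linkable D B0 I)
    (hIm : ¬ MaximalIn (Linkable D B0) I) (hB : MaximalIn (Linkable D B0) B) :
    ∃ x ∈ B \ I, Linkable D B0 (insert x I) := by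
  have : ∃ z, z ∉ I ∧ Linkable D B0 (insert z I) := by
    by_contra hcon
    push Not at hcon
    refine hIm ⟨hI, fun J hJ hIJ => Set.Subset.antisymm (fun z hz => ?_) hIJ⟩
    by_contra hzI
    exact hcon z hzI (hJ.mono' (Set.insert_subset hz hIJ))
  obtain ⟨z, hzI, hz⟩ := this
  by_cases hzB : z ∈ B
  · exact ⟨z, ⟨hzB, hzI⟩, hz⟩
  obtain ⟨S, hSA, hS, hU⟩ := lemU hD hz hB.1
  have hSB := hB.2 _ hS Set.subset_union_left
  have hzS : z ∉ S := fun h => hzB (hSB ▸ Or.inr h)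
  obtain ⟨J, hJ, hJs, hzJ, hf1, hf2, hc⟩ := hU z (Set.mem_insert _ _) hzB hzS
  have e1 : insert z I \ J = insert z (I \ J) := Set.insert_sdiff_of_notMem _ hzJ
  have hf : (I \ J).Finite := hf1.subset (by rw [e1]; exact Set.subset_insert _ _)
  have e2 : J \ insert z I ⊆ J \ I := fun x hx => ⟨hx.1, fun h => hx.2 (Or.inr h)⟩
  have hlt : (I \ J).encard < (J \ I).encard := by
    refine lt_of_lt_of_le ?_ (Set.encard_le_encard e2)
    rw [← hf.cast_ncard_eq, ← hf2.cast_ncard_eq]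
    rw [e1, Set.ncard_insert_of_notMem (fun h => hzI h.1) hf] at hc
    exact_mod_cast hc
  obtain ⟨y, hy, hyI⟩ := lemAug hD hI hJ hf hlt
  refine ⟨y, ⟨?_, hy.2⟩, hyI⟩
  rcases hJs hy.1 with (h | h) | h
  · exact absurd (h ▸ hy.1) hzJ
  · exact absurd h hy.2
  · exact h

/-- The finitarisation as a matroid. -/
def finMatroid (hD : IsDimaze D B0) : Matroid V :=
  (IndepMatroid.ofFinitaryCardAugment Set.univ (Finitarisation (Linkable D B0))
    (fun _ hJ _ => linkable_empty.mono' hJ)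
    (fun _ _ hJ hIJ K hK hf => hJ K (hK.trans hIJ) hf)
    (fun I J hI hfI hJ hfJ hc => by
      have hI' := hI I subset_rfl hfI
      have hJ' := hJ J subset_rfl hfJ
      have hlt : (I \ J).encard < (J \ I).encard := by
        have f3 := Set.ncard_inter_add_ncard_sdiff_eq_ncard I J hfI
        have f4 := Set.ncard_inter_add_ncard_sdiff_eq_ncard J I hfJ
        rw [Set.inter_comm] at f4
        rw [← (hfI.sdiff (t := J)).cast_ncard_eq, ← (hfJ.sdiff (t := I)).cast_ncard_eq]
        norm_cast
        omega
      obtain ⟨y, hy, h⟩ := lemAug hD hI' hJ' hfI.sdiff hlt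
      exact ⟨y, hy.1, hy.2, fun K hK _ => h.mono' hK⟩)
    (fun I h J hJ hf => h J hJ hf J subset_rfl hf)
    (fun _ _ => Set.subset_univ _)).matroid

theorem finMatroid_indep (hD : IsDimaze D B0) (I : Set V) :
    (finMatroid hD).Indep I ↔ Finitarisation (Linkable D B0) I := Iff.rfl

theorem finMatroid_E (hD : IsDimaze D B0) : (finMatroid hD).E = Set.univ := rfl

theorem lemIM_start (hD : IsDimaze D B0) (h : NearlyFinitary (Linkable D B0)) {I X : Set V}
    (hI : Linkable D B0 I) (hIX : I ⊆ X) :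
    ∃ J B, Linkable D B0 J ∧ I ⊆ J ∧ J ⊆ B ∧ (finMatroid hD).IsBasis B X ∧ (B \ J).Finite := by
  have hIi : (finMatroid hD).Indep I := fun K hK _ => hI.mono' hK
  obtain ⟨B, hB, hIB⟩ := hIi.subset_isBasis_of_subset hIX (Set.subset_univ _)
  obtain ⟨B', hB', hBB'⟩ := hB.indep.exists_isBase_superset
  obtain ⟨I', hI', hfin⟩ := h B' ⟨hB'.indep, fun J hJ hBJ => (hB'.eq_of_subset_indep hJ hBJ).symm⟩
  have hI'' : Linkable D B0 (I' ∩ B) := hI'.mono' Set.inter_subset_left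
  have hf : (B \ (I' ∩ B)).Finite := hfin.subset fun x hx => ⟨hBB' hx.1, fun h => hx.2 ⟨h, hx.1⟩⟩
  have hf' : (I \ (I' ∩ B)).Finite := hf.subset (Set.sdiff_subset_sdiff_left hIB)
  obtain ⟨J, hJ, h1, h2, h3⟩ := lemA hD hI hI'' hf'
  refine ⟨J, B, hJ, h1, h2.trans (Set.union_subset hIB Set.inter_subset_right), hB, ?_⟩
  have hf3 : ((I' ∩ B) \ J).Finite := by
    rw [← Set.encard_lt_top_iff] at hf' ⊢
    exact h3.trans_lt hf'
  refine (hf.union hf3).subset fun x hx => ?_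
  by_cases hxI : x ∈ I' ∩ B
  · exact Or.inr ⟨hxI, hx.2⟩
  · exact Or.inl ⟨hx.1, hxI⟩

theorem lemIM_end (hD : IsDimaze D B0) {X : Set V} (n : ℕ) : ∀ J B : Set V,
    Linkable D B0 J → J ⊆ B → (finMatroid hD).IsBasis B X → (B \ J).Finite → (B \ J).ncard = n →
    ∃ K, Linkable D B0 K ∧ J ⊆ K ∧ K ⊆ X ∧ ∀ L, Linkable D B0 L → L ⊆ X → K ⊆ L → L = K := by
  induction n using Nat.strong_induction_on with
  | _ n ih =>
  intro J B hJ hJB hB hf hn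
  by_cases hmax : ∀ x ∈ X, x ∉ J → ¬ Linkable D B0 (insert x J)
  · refine ⟨J, hJ, subset_rfl, hJB.trans hB.subset, fun L hL hLX hJL => ?_⟩
    refine Set.Subset.antisymm (fun x hx => ?_) hJL
    by_contra hxJ
    exact hmax x (hLX hx) hxJ (hL.mono' (Set.insert_subset hx hJL))
  push Not at hmax
  obtain ⟨x, hxX, hxJ, hx⟩ := hmax
  suffices hs : ∃ B', (finMatroid hD).IsBasis B' X ∧ insert x J ⊆ B' ∧
      B' \ insert x J ⊂ B \ J by
    obtain ⟨B', hB', hxB', hss⟩ := hs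
    obtain ⟨K, k1, k2, k3, k4⟩ := ih _ (hn ▸ Set.ncard_lt_ncard hss hf) (insert x J) B' hx hxB' hB'
      (hf.subset hss.subset) rfl
    exact ⟨K, k1, (Set.subset_insert _ _).trans k2, k3, k4⟩
  by_cases hxB : x ∈ B
  · refine ⟨B, hB, Set.insert_subset hxB hJB, ?_⟩
    refine ⟨Set.sdiff_subset_sdiff_right (Set.subset_insert _ _), fun h => ?_⟩
    exact (h ⟨hxB, hxJ⟩).2 (Set.mem_insert _ _)
  have hxi : (finMatroid hD).Indep (insert x J) := fun K hK _ => hx.mono' hK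
  obtain ⟨B', hB', hsub⟩ := hxi.subset_isBasis_of_subset
    (Set.insert_subset_insert hJB : insert x J ⊆ insert x B) (Set.subset_univ _)
  have hBx : (finMatroid hD).IsBasis B (insert x B) :=
    hB.isBasis_subset (Set.subset_insert _ _) (Set.insert_subset hxX hB.subset)
  have hB'X : (finMatroid hD).IsBasis B' X := by
    rw [Matroid.isBasis_iff_indep_subset_closure]
    refine ⟨hB'.indep, hB'.subset.trans (Set.insert_subset hxX hB.subset), ?_⟩
    rw [hB'.closure_eq_closure, ← hBx.closure_eq_closure]
    exact hB.subset_closure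
  refine ⟨B', hB'X, hsub, ?_, fun h => ?_⟩
  · intro y hy
    rcases hB'.subset hy.1 with rfl | h
    · exact absurd (Set.mem_insert _ _) hy.2
    · exact ⟨h, fun h' => hy.2 (Or.inr h')⟩
  · have hBB' : B ⊆ B' := by
      intro y hy
      by_cases hyJ : y ∈ J
      · exact hsub (Or.inr hyJ)
      · exact (h ⟨hy, hyJ⟩).1
    have := hB.eq_of_subset_indep hB'X.indep hBB' hB'X.subset
    exact hxB (this ▸ hsub (Set.mem_insert _ _))

end aux

/-- If the linkability system of a dimaze is nearly finitary, then it is a matroid. -/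
theorem nearlyFinitary_linkability_matroid (D : V → V → Prop) (B0 : Set V)
    (hD : IsDimaze D B0) (h : NearlyFinitary (Linkable D B0)) :
    IsMatroidIndep (Linkable D B0) := by
  refine ⟨linkable_empty, fun I J hIJ hJ => hJ.mono' hIJ,
    fun I B hI hIm hB => lemI3 hD hI hIm hB, fun I X hI hIX => ?_⟩
  obtain ⟨J, B, hJ, hIJ, hJB, hB, hf⟩ := lemIM_start hD h hI hIX
  obtain ⟨K, h1, h2, h3, h4⟩ := lemIM_end hD _ J B hJ hJB hB hf rfl
  exact ⟨K, h1, hIJ.trans h2, h3, h4⟩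
end

section
/- For any tree G with an ordered vertex bipartition (V, W), the set system M_T(G), whose independent sets are the subsets of V matchable into W, is a matroid; in particular it satisfies the maximality axiom (IM): every matchable set I ⊆ X ⊆ V extends to a maximal matchable set contained in X. -/
open Set

universe u

variable {V : Type*}

/-- `m` is a matching of `I` along the relation `Ad`. -/
def TTMt {α : Type*} (Ad : α → α → Prop) (I : Set α) (m : α → α) : Prop :=
  Set.InjOn m I ∧ ∀ v ∈ I, Ad v (m v)

lemma tt_root {α : Type*} (G : SimpleGraph α) (hT : G.IsTree) :
    ∃ (p : α → α) (d : α → ℕ), ∀ a b, G.Adj a b →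
      (b = p a ∧ d a = d b + 1) ∨ (a = p b ∧ d b = d a + 1) := by
  classical
  obtain ⟨r⟩ := hT.1.nonempty
  have key : ∀ a b b', G.Adj a b → G.Adj a b' → G.dist r a = G.dist r b + 1 →
      G.dist r a = G.dist r b' + 1 → b = b' := by
    intro a b b' h h' e e'
    obtain ⟨q, hq⟩ := (hT.1.preconnected r b).exists_walk_length_eq_dist
    obtain ⟨q', hq'⟩ := (hT.1.preconnected r b').exists_walk_length_eq_dist
    have P : (q.concat h.symm).IsPath := by
      apply SimpleGraph.Walk.isPath_of_length_eq_dist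
      rw [SimpleGraph.Walk.length_concat]; omega
    have P' : (q'.concat h'.symm).IsPath := by
      apply SimpleGraph.Walk.isPath_of_length_eq_dist
      rw [SimpleGraph.Walk.length_concat]; omega
    have := (hT.existsUnique_path r a).unique P P'
    have := congrArg SimpleGraph.Walk.penultimate this
    simpa using this
  refine ⟨fun a => if h : ∃ b, G.Adj a b ∧ G.dist r a = G.dist r b + 1 then h.choose else a,
    G.dist r, ?_⟩
  have key2 : ∀ a b, G.Adj a b → G.dist r a = G.dist r b + 1 →
      b = (if h : ∃ b, G.Adj a b ∧ G.dist r a = G.dist r b + 1 then h.choose else a) := by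
    intro a b h e
    have hex : ∃ b, G.Adj a b ∧ G.dist r a = G.dist r b + 1 := ⟨b, h, e⟩
    rw [dif_pos hex]
    exact key a _ _ h hex.choose_spec.1 e hex.choose_spec.2
  intro a b h
  rcases hT.dist_eq_dist_add_one_of_adj r h with e | e
  · exact Or.inl ⟨key2 a b h e, e⟩
  · exact Or.inr ⟨key2 b a h.symm e, e⟩

lemma tt_I3 {α : Type*} (Ad : α → α → Prop) (I B : Set α) (x : α) (m n : α → α)
    (hm : TTMt Ad (insert x I) m) (hn : TTMt Ad B n) (hx : x ∉ I)
    (hno : ∀ b ∈ B \ I, ¬ ∃ f, TTMt Ad (insert b I) f) :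
    x ∉ B ∧ ∃ f, TTMt Ad (insert x B) f := by
  classical
  have hxB : x ∉ B := fun h => hno x ⟨h, hx⟩ ⟨m, hm⟩
  have hmI : Set.InjOn m I := hm.1.mono (Set.subset_insert _ _)
  let R : α → α → Prop := fun z u => z ∈ B ∧ u ∈ I ∧ n z = m u
  let D : Set α := {u | ∃ b ∈ B \ I, Relation.ReflTransGen R b u}
  have hDsub : ∀ b u, Relation.ReflTransGen R b u → u = b ∨ u ∈ I := by
    intro b u h
    rcases Relation.ReflTransGen.cases_tail h with h | ⟨c, _, h⟩
    · exact Or.inl h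
    · exact Or.inr h.2.1
  have claim : ∀ u ∈ D, u ∈ B → ∃ z ∈ I, n u = m z := by
    rintro u ⟨b, hb, hbu⟩ huB
    by_contra hcon
    push Not at hcon
    apply hno b hb
    let Y : Set α := {y | Relation.ReflTransGen R b y ∧ Relation.ReflTransGen R y u}
    have hYB : ∀ y ∈ Y, y ∈ B := by
      rintro y ⟨_, h2⟩
      rcases Relation.ReflTransGen.cases_head h2 with h | ⟨c, h, _⟩
      · exact h ▸ huB
      · exact h.1
    have hbY : b ∈ Y := ⟨.refl, hbu⟩
    have cross : ∀ y ∈ Y, ∀ z ∈ insert b I, z ∉ Y → n y ≠ m z := by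
      rintro y ⟨h1, h2⟩ z hz hzY he
      have hzI : z ∈ I := by
        rcases hz with rfl | h
        · exact absurd hbY hzY
        · exact h
      rcases Relation.ReflTransGen.cases_head h2 with h | ⟨c, h, h3⟩
      · exact hcon z hzI (h ▸ he)
      · have : c = z := hmI h.2.1 hzI (h.2.2.symm.trans he)
        exact hzY (this ▸ ⟨h1.tail h, h3⟩)
    refine ⟨fun y => if y ∈ Y then n y else m y, ?_, ?_⟩
    · intro y hy z hz he
      by_cases h1 : y ∈ Y <;> by_cases h2 : z ∈ Y <;> simp only [h1, h2, if_true, if_false] at he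
      · exact hn.1 (hYB y h1) (hYB z h2) he
      · exact absurd he (cross y h1 z hz h2)
      · exact absurd he.symm (cross z h2 y hy h1)
      · refine hmI ?_ ?_ he
        · rcases hy with rfl | h
          · exact absurd hbY h1
          · exact h
        · rcases hz with rfl | h
          · exact absurd hbY h2
          · exact h
    · intro y hy
      by_cases h1 : y ∈ Y <;> simp only [h1, if_true, if_false]
      · exact hn.2 y (hYB y h1)
      · rcases hy with rfl | h
        · exact absurd hbY h1
        · exact hm.2 y (Or.inr h)
  have hxD : x ∉ D := by
    rintro ⟨b, hb, h⟩
    rcases hDsub b x h with h | h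
    · exact hxB (h ▸ hb.1)
    · exact hx h
  have hBD : ∀ y ∈ insert x B, y ∉ D → y ∈ insert x I := by
    rintro y (rfl | h) hD
    · exact Or.inl rfl
    · by_contra hc
      exact hD ⟨y, ⟨h, fun h' => hc (Or.inr h')⟩, .refl⟩
  have hBD' : ∀ y ∈ insert x B, y ∈ D → y ∈ B := by
    rintro y (rfl | h) hD
    · exact absurd hD hxD
    · exact h
  have cross : ∀ y ∈ insert x B, y ∈ D → ∀ z ∈ insert x B, z ∉ D → n y ≠ m z := by
    intro y hy hyD z hz hzD he
    obtain ⟨u, huI, hu⟩ := claim y hyD (hBD' y hy hyD)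
    have : u = z := hm.1 (Or.inr huI) (hBD z hz hzD) (hu.symm.trans he)
    obtain ⟨b, hb, hby⟩ := hyD
    exact hzD (this ▸ ⟨b, hb, hby.tail ⟨hBD' y hy ⟨b, hb, hby⟩, huI, hu⟩⟩)
  refine ⟨hxB, fun y => if y ∈ D then n y else m y, ?_, ?_⟩
  · intro y hy z hz he
    by_cases h1 : y ∈ D <;> by_cases h2 : z ∈ D <;> simp only [h1, h2, if_true, if_false] at he
    · exact hn.1 (hBD' y hy h1) (hBD' z hz h2) he
    · exact absurd he (cross y hy h1 z hz h2)
    · exact absurd he.symm (cross z hz h2 y hy h1)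
    · exact hm.1 (hBD y hy h1) (hBD z hz h2) he
  · intro y hy
    by_cases h1 : y ∈ D <;> simp only [h1, if_true, if_false]
    · exact hn.2 y (hBD' y hy h1)
    · exact hm.2 y (hBD y hy h1)

lemma tt_stageA {α : Type*} (Ad : α → α → Prop) (p : α → α) (d : α → ℕ)
    (hp : ∀ a b, Ad a b → (b = p a ∧ d a = d b + 1) ∨ (a = p b ∧ d b = d a + 1))
    (X I0 : Set α) (m0 : α → α) (h0 : TTMt Ad I0 m0) (h0X : I0 ⊆ X) :
    ∃ (I : Set α) (m : α → α), TTMt Ad I m ∧ I0 ⊆ I ∧ I ⊆ X ∧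
      ∀ K n, TTMt Ad K n → I ⊆ K → K ⊆ X → ∀ v ∈ K, d v < d (n v) → v ∈ I ∧ d v < d (m v) := by
  classical
  let S := {q : Set α × (α → α) // TTMt Ad q.1 q.2 ∧ I0 ⊆ q.1 ∧ q.1 ⊆ X}
  let r : S → S → Prop := fun a b => a.1.1 ⊆ b.1.1 ∧
    ∀ v ∈ a.1.1, a.1.2 v = b.1.2 v ∨ (d (a.1.2 v) < d v ∧ d v < d (b.1.2 v))
  have rrefl : ∀ a, r a a := fun a => ⟨subset_rfl, fun v _ => Or.inl rfl⟩
  have rtrans : ∀ {a b c}, r a b → r b c → r a c := by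
    intro a b c h1 h2
    refine ⟨h1.1.trans h2.1, fun v hv => ?_⟩
    rcases h1.2 v hv with e | e <;> rcases h2.2 v (h1.1 hv) with e' | e'
    · exact Or.inl (e.trans e')
    · exact Or.inr (by rw [e]; exact e')
    · exact Or.inr (by rw [← e']; exact e)
    · omega
  obtain ⟨M, hM⟩ := exists_maximal_of_chains_bounded (r := r) (by
    intro c hc
    rcases c.eq_empty_or_nonempty with rfl | ⟨q0, hq0⟩
    · exact ⟨⟨(I0, m0), h0, subset_rfl, h0X⟩, by simp⟩
    have htot : ∀ a ∈ c, ∀ b ∈ c, r a b ∨ r b a := by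
      intro a ha b hb
      by_cases h : a = b
      · exact Or.inl (h ▸ rrefl a)
      · exact hc ha hb h
    let I : Set α := {v | ∃ a ∈ c, v ∈ a.1.1}
    -- eventual values
    have hev : ∀ v, ∃ y, v ∈ I → ∃ a ∈ c, v ∈ a.1.1 ∧ ∀ b ∈ c, r a b → b.1.2 v = y := by
      intro v
      by_cases h : ∃ a ∈ c, v ∈ a.1.1 ∧ d v < d (a.1.2 v)
      · obtain ⟨a, ha, hv, hd⟩ := h
        refine ⟨a.1.2 v, fun _ => ⟨a, ha, hv, fun b hb hab => ?_⟩⟩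
        rcases hab.2 v hv with e | e
        · exact e.symm
        · omega
      · refine ⟨p v, fun ⟨a, ha, hv⟩ => ⟨a, ha, hv, fun b hb hab => ?_⟩⟩
        rcases hp v _ (b.2.1.2 v (hab.1 hv)) with e | e
        · exact e.1
        · exact absurd ⟨b, hb, hab.1 hv, by omega⟩ h
    choose f hf using hev
    have hfd : ∀ a ∈ c, ∀ v ∈ a.1.1, ∃ b ∈ c, r a b ∧ ∀ e ∈ c, r b e → e.1.2 v = f v := by
      intro a ha v hv
      obtain ⟨a', ha', hv', h⟩ := hf v ⟨a, ha, hv⟩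
      rcases htot a ha a' ha' with h1 | h1
      · exact ⟨a', ha', h1, h⟩
      · exact ⟨a, ha, rrefl a, fun e he hae => h e he (rtrans h1 hae)⟩
    have hI : TTMt Ad I f := by
      constructor
      · intro v hv z hz he
        obtain ⟨a, ha, hva, h1⟩ := hf v hv
        obtain ⟨b, hb, hzb, h2⟩ := hf z hz
        rcases htot a ha b hb with h | h
        · exact b.2.1.1 (h.1 hva) hzb (by rw [h1 b hb h, h2 b hb (rrefl b), he])
        · exact a.2.1.1 hva (h.1 hzb) (by rw [h1 a ha (rrefl a), h2 a ha h, he])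
      · intro v hv
        obtain ⟨a, ha, hva, h1⟩ := hf v hv
        rw [← h1 a ha (rrefl a)]
        exact a.2.1.2 v hva
    refine ⟨⟨(I, f), hI, fun v hv => ⟨q0, hq0, q0.2.2.1 hv⟩, ?_⟩, ?_⟩
    · rintro v ⟨a, ha, hva⟩
      exact a.2.2.2 hva
    · intro a ha
      refine ⟨fun v hv => ⟨a, ha, hv⟩, fun v hv => ?_⟩
      obtain ⟨b, hb, hab, h⟩ := hfd a ha v hv
      have := h b hb (rrefl b)
      change a.1.2 v = f v ∨ (_ ∧ d v < d (f v))
      rw [← this]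
      exact hab.2 v hv) rtrans
  obtain ⟨⟨I, m⟩, hm, hI0, hIX⟩ := M
  have hm : TTMt Ad I m := hm
  refine ⟨I, m, hm, hI0, hIX, ?_⟩
  intro K n hn hIK hKX v hv hd
  by_contra hcon
  let R : α → α → Prop := fun z u => u ∈ I ∧ n z = m u
  let Z : Set α := {z | Relation.ReflTransGen R v z}
  have hZ : ∀ z ∈ Z, z ∈ K ∧ d z < d (n z) ∧ (z = v ∨ z ∈ I) ∧ (z ∈ I → d (m z) < d z) := by
    intro z hz
    induction hz with
    | refl =>
      refine ⟨hv, hd, Or.inl rfl, fun h => ?_⟩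
      have := hp v _ (hm.2 v h)
      by_contra h'
      exact hcon ⟨h, by omega⟩
    | @tail b c _ hbc ih =>
      obtain ⟨hbK, hbd, _, hbm⟩ := ih
      obtain ⟨hcI, he⟩ := hbc
      have hA := hp _ _ (hn.2 b hbK)
      have hB := hp _ _ (hm.2 c hcI)
      have hC := hp _ _ (hn.2 c (hIK hcI))
      rw [← he] at hB
      have hup : n b = p c ∧ d c = d (n b) + 1 := by
        rcases hB with h | h
        · exact h
        · exfalso
          have hbc : b = c := by
            rcases hA with h' | h'
            · omega
            · rw [h'.1, h.1]
          subst hbc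
          have := hbm hcI
          rw [← he] at this
          omega
      refine ⟨hIK hcI, ?_, Or.inr hcI, fun _ => by rw [← he]; omega⟩
      rcases hC with h | h
      · have : b = c := hn.1 hbK (hIK hcI) (by rw [hup.1, h.1])
        subst this
        omega
      · omega
  have hvZ : v ∈ Z := .refl
  have cross : ∀ y ∈ Z, ∀ z ∈ insert v I, z ∉ Z → n y ≠ m z := by
    intro y hy z hz hzZ he
    rcases hz with rfl | hz
    · exact hzZ hvZ
    · exact hzZ (Relation.ReflTransGen.tail hy ⟨hz, he⟩)
  have hI' : ∀ z ∈ insert v I, z ∉ Z → z ∈ I := by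
    rintro z (rfl | h) hz
    · exact absurd hvZ hz
    · exact h
  have hnew : TTMt Ad (insert v I) (fun y => if y ∈ Z then n y else m y) := by
    constructor
    · intro y hy z hz he
      by_cases h1 : y ∈ Z <;> by_cases h2 : z ∈ Z <;> simp only [h1, h2, if_true, if_false] at he
      · exact hn.1 (hZ y h1).1 (hZ z h2).1 he
      · exact absurd he (cross y h1 z hz h2)
      · exact absurd he.symm (cross z h2 y hy h1)
      · exact hm.1 (hI' y hy h1) (hI' z hz h2) he
    · intro y hy
      by_cases h1 : y ∈ Z <;> simp only [h1, if_true, if_false]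
      · exact hn.2 y (hZ y h1).1
      · exact hm.2 y (hI' y hy h1)
  have := hM ⟨(insert v I, fun y => if y ∈ Z then n y else m y), hnew,
    hI0.trans (Set.subset_insert _ _), Set.insert_subset (hKX hv) hIX⟩ (by
      refine ⟨Set.subset_insert _ _, fun z hz => ?_⟩
      by_cases h1 : z ∈ Z <;> simp only [h1, if_true, if_false]
      · exact Or.inr ⟨(hZ z h1).2.2.2 hz, (hZ z h1).2.1⟩
      · exact Or.inl trivial)
  have hvI : v ∈ I := this.1 (Set.mem_insert _ _)
  have h2 := this.2 v (Set.mem_insert _ _)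
  simp only [hvZ, if_true] at h2
  have h3 := (hZ v hvZ).2.2.2 hvI
  rcases h2 with h | h
  · rw [← h] at h3; omega
  · omega

inductive TTAt {α : Type u} (P : α → Set α → Prop) : Ordinal.{u} → α → Prop
  | mk (o : Ordinal.{u}) (w : α) (s : Set α) (hP : P w s) (f : α → Ordinal.{u})
      (hf : ∀ x ∈ s, f x < o) (h : ∀ x ∈ s, TTAt P (f x) x) : TTAt P o w

lemma tt_rank {α : Type u} (P : α → Set α → Prop) :
    ∃ (Des : α → Prop) (rk : α → Ordinal.{u}),
      (∀ w s, P w s → (∀ x ∈ s, Des x) → Des w) ∧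
      (∀ w, Des w → ∃ s, P w s ∧ ∀ x ∈ s, Des x ∧ rk x < rk w) := by
  classical
  refine ⟨fun w => ∃ o, TTAt P o w, fun w => sInf {o | TTAt P o w}, ?_, ?_⟩
  · intro w s hP h
    have : ∀ x, ∃ o, x ∈ s → TTAt P o x := by
      intro x
      by_cases hx : x ∈ s
      · obtain ⟨o, ho⟩ := h x hx
        exact ⟨o, fun _ => ho⟩
      · exact ⟨0, fun h => absurd h hx⟩
    choose f hf using this
    refine ⟨Order.succ (⨆ x, f x), .mk _ w s hP f (fun x _ => ?_) hf⟩
    exact Order.lt_succ_of_le (Ordinal.le_iSup f x)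
  · intro w hw
    have hmem : sInf {o | TTAt P o w} ∈ {o | TTAt P o w} := csInf_mem hw
    have hmem' : TTAt P (sInf {o | TTAt P o w}) w := hmem
    change ∃ s, P w s ∧ ∀ x ∈ s, (∃ o, TTAt P o x) ∧ sInf {o | TTAt P o x} < sInf {o | TTAt P o w}
    generalize sInf {o | TTAt P o w} = o at hmem' ⊢
    cases hmem' with
    | mk _ _ s hP f hf h =>
      refine ⟨s, hP, fun x hx => ⟨⟨_, h x hx⟩, lt_of_le_of_lt (csInf_le' (h x hx)) (hf x hx)⟩⟩

lemma tt_stageB {α : Type u} (Ad : α → α → Prop) (p : α → α) (d : α → ℕ)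
    (hp : ∀ a b, Ad a b → (b = p a ∧ d a = d b + 1) ∨ (a = p b ∧ d b = d a + 1))
    (X : Set α) (hX : ∀ a ∈ X, ∀ b ∈ X, ¬ Ad a b) (I : Set α) (m : α → α) (hm : TTMt Ad I m)
    (hIX : I ⊆ X)
    (hA : ∀ K n, TTMt Ad K n → I ⊆ K → K ⊆ X → ∀ v ∈ K, d v < d (n v) → v ∈ I ∧ d v < d (m v)) :
    ∃ (J : Set α) (j : α → α), TTMt Ad J j ∧ I ⊆ J ∧ J ⊆ X ∧
      ∀ K n, TTMt Ad K n → K ⊆ X → J ⊆ K → K = J := by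
  classical
  obtain ⟨Free, hFree⟩ : ∃ F : α → Prop, ∀ w, F w ↔ ∀ v ∈ I, m v ≠ w := ⟨_, fun _ => Iff.rfl⟩
  obtain ⟨UpN, hUpN⟩ : ∃ F : α → Prop, ∀ a, F a ↔ (Ad a (p a) ∧ d a = d (p a) + 1) :=
    ⟨_, fun _ => Iff.rfl⟩
  obtain ⟨Side, hSide⟩ : ∃ F : α → α → Prop, ∀ v w, F v w ↔ (Free w ∧ Ad v w ∧ d v < d w) :=
    ⟨_, fun _ _ => Iff.rfl⟩
  obtain ⟨Up, hUp⟩ : ∃ F : α → α → Prop, ∀ a b,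
      F a b ↔ (b ∈ I ∧ UpN a ∧ m b = p a ∧ d b < d (m b)) := ⟨_, fun _ _ => Iff.rfl⟩
  have sideP : ∀ v w, Side v w → v = p w := by
    intro v w h
    rw [hSide] at h
    rcases hp v w h.2.1 with h' | h'
    · omega
    · exact h'.1
  have upDepth : ∀ a b, Up a b → d b < d a := by
    intro a b h
    rw [hUp, hUpN] at h
    have := h.2.2.2
    rw [h.2.2.1] at this
    omega
  have upUniq : ∀ a b c, Up a b → Up a c → b = c := by
    intro a b c h1 h2
    rw [hUp] at h1 h2
    exact hm.1 h1.1 h2.1 (h1.2.2.1.trans h2.2.2.1.symm)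
  have freeStuck : ∀ a b, Free (p a) → ¬ Up a b := by
    intro a b h h'
    rw [hUp] at h'
    rw [hFree] at h
    exact h b h'.1 h'.2.2.1
  obtain ⟨Des, rk, hDes1, hDes2⟩ := tt_rank (fun (w : α) (s : Set α) => Free w ∧
    ∃ x, x ∈ X ∧ x ∉ I ∧ ∃ c, Relation.ReflTransGen Up x c ∧ UpN c ∧ p c = w ∧
      s = {w' | ∃ v, Relation.ReflTransGen Up x v ∧ Side v w'})
  obtain ⟨own, hown⟩ : ∃ F : α → Prop, ∀ v, F v ↔ ∃ w, Side v w ∧ ¬ Des w := ⟨_, fun _ => Iff.rfl⟩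
  obtain ⟨T, hTd⟩ : ∃ F : α → α → Prop, ∀ a b, F a b ↔ (Up a b ∧ ¬ own a) := ⟨_, fun _ _ => Iff.rfl⟩
  obtain ⟨TopAt, hTopAt⟩ : ∃ F : α → α → Prop, ∀ t τ, F t τ ↔
    ((own t ∧ τ = t) ∨ (¬ own t ∧ UpN t ∧ Free (p t) ∧ τ = p t)) := ⟨_, fun _ _ => Iff.rfl⟩
  obtain ⟨IsTop, hIsTop⟩ : ∃ F : α → α → Prop, ∀ x τ, F x τ ↔
    ∃ t, Relation.ReflTransGen T x t ∧ TopAt t τ := ⟨_, fun _ _ => Iff.rfl⟩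
  have tUniq : Relator.RightUnique T := by
    intro a b c h1 h2
    rw [hTd] at h1 h2
    exact upUniq a b c h1.1 h2.1
  have stuck : ∀ t τ b, TopAt t τ → ¬ T t b := by
    intro t τ b h h'
    rw [hTopAt] at h
    rw [hTd] at h'
    rcases h with h | h
    · exact h'.2 h.1
    · exact freeStuck t b h.2.2.1 h'.1
  have stuck' : ∀ t τ b, TopAt t τ → Relation.ReflTransGen T t b → b = t := by
    intro t τ b h h'
    rcases Relation.ReflTransGen.cases_head h' with h1 | ⟨c, h1, _⟩
    · exact h1.symm
    · exact absurd h1 (stuck t τ c h)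
  have topAtUniq : ∀ t τ τ', TopAt t τ → TopAt t τ' → τ = τ' := by
    intro t τ τ' h h'
    rw [hTopAt] at h h'
    rcases h with h | h <;> rcases h' with h' | h'
    · exact h.2.trans h'.2.symm
    · exact absurd h.1 h'.1
    · exact absurd h'.1 h.1
    · exact h.2.2.2.trans h'.2.2.2.symm
  have topDown : ∀ x u τ, IsTop x τ → Relation.ReflTransGen T x u → IsTop u τ := by
    intro x u τ h hu
    rw [hIsTop] at h ⊢
    obtain ⟨t, ht, hτ⟩ := h
    rcases Relation.ReflTransGen.total_of_right_unique tUniq ht hu with h1 | h1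
    · rw [stuck' t τ u hτ h1]
      exact ⟨t, .refl, hτ⟩
    · exact ⟨t, h1, hτ⟩
  have topUniq : ∀ x τ τ', IsTop x τ → IsTop x τ' → τ = τ' := by
    intro x τ τ' h h'
    rw [hIsTop] at h h'
    obtain ⟨t, ht, hτ⟩ := h
    obtain ⟨t', ht', hτ'⟩ := h'
    have : t = t' := by
      rcases Relation.ReflTransGen.total_of_right_unique tUniq ht ht' with h1 | h1
      · exact (stuck' t τ t' hτ h1).symm
      · exact stuck' t' τ' t hτ' h1
    subst this
    exact topAtUniq t τ τ' hτ hτ'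
  have tDepth : ∀ a b, Relation.ReflTransGen T a b → a = b ∨ d b < d a := by
    intro a b h
    induction h with
    | refl => exact Or.inl rfl
    | @tail b c _ hbc ih =>
      rw [hTd] at hbc
      have := upDepth b c hbc.1
      rcases ih with rfl | h
      · exact Or.inr this
      · exact Or.inr (by omega)
  have tSame : ∀ y u u', Relation.ReflTransGen T y u → Relation.ReflTransGen T y u' →
      d u = d u' → u = u' := by
    intro y u u' h h' hd
    rcases Relation.ReflTransGen.total_of_right_unique tUniq h h' with h1 | h1
    · rcases tDepth _ _ h1 with h2 | h2
      · exact h2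
      · omega
    · rcases tDepth _ _ h1 with h2 | h2
      · exact h2.symm
      · omega
  have noOwn : ∀ x t, Relation.ReflTransGen T x t → ¬ own t → Free (p t) →
      ∀ v, Relation.ReflTransGen Up x v → ¬ own v := by
    intro x t h hto hf
    induction h using Relation.ReflTransGen.head_induction_on with
    | refl =>
      intro v hv
      rcases Relation.ReflTransGen.cases_head hv with h1 | ⟨c, h1, _⟩
      · exact h1 ▸ hto
      · exact absurd h1 (freeStuck t c hf)
    | @head a c hac _ ih =>
      intro v hv
      rw [hTd] at hac
      rcases Relation.ReflTransGen.cases_head hv with h1 | ⟨c', h1, h2⟩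
      · exact h1 ▸ hac.2
      · rw [← upUniq _ _ _ hac.1 h1] at h2
        exact ih v h2
  have desTop : ∀ x t, x ∈ X → x ∉ I → Relation.ReflTransGen T x t → ¬ own t → UpN t →
      Free (p t) → Des (p t) := by
    intro x t hxX hxI h hto hun hf
    refine hDes1 (p t) _ ⟨hf, x, hxX, hxI, t, ?_, hun, rfl, rfl⟩ ?_
    · exact Relation.ReflTransGen.mono (fun a b hab => ((hTd a b).1 hab).1) _ _ h
    · rintro w ⟨v, hv, hs⟩
      have := noOwn x t h hto hf v hv
      rw [hown] at this
      push Not at this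
      exact this w hs
  -- choice of the representatives
  have hchoice : ∀ τ, ∃ x, (∃ y, y ∈ X ∧ y ∉ I ∧ IsTop y τ) → x ∈ X ∧ x ∉ I ∧ IsTop x τ ∧
      (Des τ → ∃ c, Relation.ReflTransGen Up x c ∧ UpN c ∧ p c = τ ∧
        ∀ v w, Relation.ReflTransGen Up x v → Side v w → Des w ∧ rk w < rk τ) := by
    intro τ
    by_cases hτ : Des τ
    · obtain ⟨s, ⟨hf, x, hxX, hxI, c, hc, hun, hpc, rfl⟩, hs⟩ := hDes2 τ hτ
      have hno : ∀ v, Relation.ReflTransGen Up x v → ¬ own v := by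
        intro v hv ho
        rw [hown] at ho
        obtain ⟨w, hw, hw'⟩ := ho
        exact hw' (hs w ⟨v, hv, hw⟩).1
      have hT' : ∀ v, Relation.ReflTransGen Up x v → Relation.ReflTransGen T x v := by
        intro v hv
        induction hv with
        | refl => exact .refl
        | @tail b c hb hbc ih => exact ih.tail ((hTd _ _).2 ⟨hbc, hno b hb⟩)
      refine ⟨x, fun _ => ⟨hxX, hxI, ?_, fun _ => ⟨c, hc, hun, hpc, fun v w hv hw => hs w ⟨v, hv, hw⟩⟩⟩⟩
      rw [hIsTop]
      refine ⟨c, hT' c hc, ?_⟩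
      rw [hTopAt]
      exact Or.inr ⟨hno c hc, hun, hpc ▸ hf, hpc.symm⟩
    · by_cases h : ∃ y, y ∈ X ∧ y ∉ I ∧ IsTop y τ
      · obtain ⟨y, h1, h2, h3⟩ := h
        exact ⟨y, fun _ => ⟨h1, h2, h3, fun h => absurd h hτ⟩⟩
      · exact ⟨τ, fun h' => absurd h' h⟩
  choose ξ hξ using hchoice
  have hown' : ∀ v, ∃ w, own v → Side v w ∧ ¬ Des w := by
    intro v
    by_cases h : own v
    · obtain ⟨w, hw⟩ := (hown v).1 h
      exact ⟨w, fun _ => hw⟩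
    · exact ⟨v, fun h' => absurd h' h⟩
  choose e he using hown'
  obtain ⟨HT, hHT⟩ : ∃ F : α → Prop, ∀ τ, F τ ↔ ∃ y, y ∈ X ∧ y ∉ I ∧ IsTop y τ :=
    ⟨_, fun _ => Iff.rfl⟩
  simp only [← hHT] at hξ
  obtain ⟨Fl, hFl⟩ : ∃ F : α → Prop, ∀ u, F u ↔ ∃ τ, HT τ ∧ Relation.ReflTransGen T (ξ τ) u :=
    ⟨_, fun _ => Iff.rfl⟩
  let J : Set α := I ∪ {x | ∃ τ, HT τ ∧ x = ξ τ}
  have hJX : J ⊆ X := by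
    rintro x (h | ⟨τ, h, rfl⟩)
    · exact hIX h
    · exact (hξ τ h).1
  have hJu : ∀ u ∈ J, ¬ Fl u → u ∈ I := by
    rintro u (h | ⟨τ, h, rfl⟩) hf
    · exact h
    · exact absurd ((hFl _).2 ⟨τ, h, .refl⟩) hf
  have hFlstep : ∀ u, Fl u → ¬ own u → UpN u ∧
      ((∃ b, b ∈ I ∧ m b = p u ∧ T u b ∧ Fl b) ∨ (Free (p u) ∧ Des (p u) ∧ HT (p u) ∧
        Relation.ReflTransGen T (ξ (p u)) u)) := by
    intro u hu ho
    obtain ⟨τ, hτ, hu'⟩ := (hFl u).1 hu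
    have h1 := hξ τ hτ
    have := topDown _ u τ h1.2.2.1 hu'
    rw [hIsTop] at this
    obtain ⟨t, ht, hta⟩ := this
    rcases Relation.ReflTransGen.cases_head ht with h | ⟨b, hb, _⟩
    · subst h
      rw [hTopAt] at hta
      rcases hta with h | ⟨_, h2, h3, h4⟩
      · exact absurd h.1 ho
      · subst h4
        exact ⟨h2, Or.inr ⟨h3, desTop _ u h1.1 h1.2.1 hu' ho h2 h3, hτ, hu'⟩⟩
    · have hb' := (hUp _ _).1 ((hTd _ _).1 hb).1
      exact ⟨hb'.2.1, Or.inl ⟨b, hb'.1, hb'.2.2.1, hb, (hFl b).2 ⟨τ, hτ, hu'.tail hb⟩⟩⟩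
  have cross : ∀ u ∈ J, Fl u → ∀ z ∈ J, ¬ Fl z → (if own u then e u else p u) ≠ m z := by
    intro u hu hfu z hz hfz heq
    have hzI := hJu z hz hfz
    by_cases ho : own u
    · rw [if_pos ho] at heq
      have := ((hSide _ _).1 (he u ho).1).1
      exact (hFree _).1 this z hzI heq.symm
    · rw [if_neg ho] at heq
      obtain ⟨_, ⟨b, hbI, hb, _, hfb⟩ | ⟨h, _⟩⟩ := hFlstep u hfu ho
      · have : b = z := hm.1 hbI hzI (hb.trans heq)
        exact hfz (this ▸ hfb)
      · exact (hFree _).1 h z hzI heq.symm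
  have cross2 : ∀ u, Fl u → own u → ∀ z, Fl z → ¬ own z → e u ≠ p z := by
    intro u hfu ho z hfz hoz heq
    have hs := he u ho
    obtain ⟨_, ⟨b, hbI, hb, _, hfb⟩ | ⟨_, h, _⟩⟩ := hFlstep z hfz hoz
    · exact (hFree _).1 ((hSide _ _).1 hs.1).1 b hbI (hb.trans heq.symm)
    · exact hs.2 (heq ▸ h)
  have hj : TTMt Ad J (fun u => if Fl u then (if own u then e u else p u) else m u) := by
    constructor
    · intro u hu z hz heq
      by_cases h1 : Fl u <;> by_cases h2 : Fl z <;> simp only [h1, h2, if_true, if_false] at heq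
      · by_cases h3 : own u <;> by_cases h4 : own z <;> simp only [h3, h4, if_true, if_false] at heq
        · rw [sideP _ _ (he u h3).1, sideP _ _ (he z h4).1, heq]
        · exact absurd heq (cross2 u h1 h3 z h2 h4)
        · exact absurd heq.symm (cross2 z h2 h4 u h1 h3)
        · obtain ⟨a1, a2⟩ := hFlstep u h1 h3
          obtain ⟨b1, b2⟩ := hFlstep z h2 h4
          have hd : d u = d z := by
            rw [((hUpN _).1 a1).2, ((hUpN _).1 b1).2, heq]
          rcases a2 with ⟨b, hbI, hb, hub, _⟩ | a2 <;> rcases b2 with ⟨b', hbI', hb', hzb, _⟩ | b2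
          · have hbb : b = b' := hm.1 hbI hbI' (by rw [hb, hb', heq])
            subst hbb
            obtain ⟨τ, hτ, hu'⟩ := (hFl u).1 h1
            obtain ⟨τ', hτ', hz'⟩ := (hFl z).1 h2
            have e1 := topDown _ b τ (hξ τ hτ).2.2.1 (hu'.tail hub)
            have e2 := topDown _ b τ' (hξ τ' hτ').2.2.1 (hz'.tail hzb)
            have := topUniq _ _ _ e1 e2
            subst this
            exact tSame _ _ _ hu' hz' hd
          · exact absurd (hb.trans heq) ((hFree _).1 b2.1 b hbI)
          · exact absurd (hb'.trans heq.symm) ((hFree _).1 a2.1 b' hbI')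
          · refine tSame _ _ _ a2.2.2.2 ?_ hd
            rw [heq]; exact b2.2.2.2
      · exact absurd heq (cross u hu h1 z hz h2)
      · exact absurd heq.symm (cross z hz h2 u hu h1)
      · exact hm.1 (hJu u hu h1) (hJu z hz h2) heq
    · intro u hu
      by_cases h1 : Fl u <;> simp only [h1, if_true, if_false]
      · by_cases h3 : own u <;> simp only [h3, if_true, if_false]
        · exact ((hSide _ _).1 (he u h3).1).2.1
        · exact ((hUpN _).1 (hFlstep u h1 h3).1).1
      · exact hm.2 u (hJu u hu h1)
  refine ⟨J, _, hj, Set.subset_union_left, hJX, ?_⟩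
  intro K n hn hKX hJK
  refine Set.Subset.antisymm ?_ hJK
  intro x hxK
  by_contra hxJ
  have hIK : I ⊆ K := Set.subset_union_left.trans hJK
  have hAK := hA K n hn hIK hKX
  have ndown : ∀ v ∈ K, ¬ d v < d (n v) → UpN v ∧ n v = p v := by
    intro v hv hd
    have ha := hn.2 v hv
    rcases hp _ _ ha with h | h
    · rw [h.1] at ha
      exact ⟨(hUpN _).2 ⟨ha, by rw [← h.1]; exact h.2⟩, h.1⟩
    · omega
  obtain ⟨QU, hQU⟩ : ∃ F : α → α → Prop, ∀ a b, F a b ↔ (Up a b ∧ n a = p a) :=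
    ⟨_, fun _ _ => Iff.rfl⟩
  have lemQ : ∀ y, y ∈ K → y ∉ I → ∀ u, Relation.ReflTransGen QU y u →
      u ∈ K ∧ ((UpN u ∧ n u = p u) ∨ Side u (n u)) := by
    intro y hyK hyI u hu
    induction hu with
    | refl => exact ⟨hyK, Or.inl (ndown y hyK fun h => hyI (hAK y hyK h).1)⟩
    | @tail b c _ hbc ih =>
      rw [hQU] at hbc
      have hbc' := (hUp _ _).1 hbc.1
      have hcK := hIK hbc'.1
      refine ⟨hcK, ?_⟩
      by_cases hd : d c < d (n c)
      · refine Or.inr ((hSide _ _).2 ⟨(hFree _).2 ?_, hn.2 c hcK, hd⟩)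
        intro v hvI hv
        by_cases hvd : d v < d (m v)
        · have hvc : v = c := by
            rcases hp _ _ (hm.2 v hvI) with h | h
            · omega
            · rcases hp _ _ (hn.2 c hcK) with h' | h'
              · omega
              · rw [h.1, h'.1, hv]
          subst hvc
          have : b = v := hn.1 ih.1 hcK (by rw [hbc.2, ← hv, hbc'.2.2.1])
          have h2 := upDepth _ _ hbc.1
          rw [this] at h2
          omega
        · have h1 := ndown v (hIK hvI) fun h => hvd (hAK v (hIK hvI) h).2
          have hmv : m v = p v := by
            rcases hp _ _ (hm.2 v hvI) with h | h
            · exact h.1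
            · omega
          have : v = c := hn.1 (hIK hvI) hcK (by rw [h1.2, ← hv, hmv])
          subst this
          exact hvd hbc'.2.2.2
      · exact Or.inl (ndown c hcK hd)
  have origin : ∀ y, y ∈ K → y ∉ I → ∀ y', y' ∈ K → y' ∉ I → ∀ u,
      Relation.ReflTransGen QU y u → Relation.ReflTransGen QU y' u → y = y' := by
    intro y hyK hyI y' hyK' hyI' u hu
    have stepI : ∀ a b, QU a b → b ∈ I := fun a b h => ((hUp _ _).1 ((hQU _ _).1 h).1).1
    induction hu with
    | refl =>
      intro h
      rcases Relation.ReflTransGen.cases_tail h with h | ⟨c, _, h⟩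
      · exact h
      · exact absurd (stepI _ _ h) hyI
    | @tail b c hyb hbc ih =>
      intro h
      rcases Relation.ReflTransGen.cases_tail h with h | ⟨b', h', hbc'⟩
      · exact absurd (h ▸ stepI _ _ hbc) hyI'
      · have hbb : b = b' := by
          apply hn.1 (lemQ y hyK hyI b hyb).1 (lemQ y' hyK' hyI' b' h').1
          have e1 := (hQU _ _).1 hbc
          have e2 := (hQU _ _).1 hbc'
          rw [e1.2, e2.2, ← ((hUp _ _).1 e1.1).2.2.1, ← ((hUp _ _).1 e2.1).2.2.1]
        exact ih (hbb ▸ h')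
  have hξK : ∀ τ, HT τ → ξ τ ∈ K := fun τ h => hJK (Or.inr ⟨τ, h, rfl⟩)
  have claim1 : ∀ o : Ordinal.{u}, ∀ w, rk w = o → Des w → ∀ v ∈ K, d v < d w → n v ≠ w := by
    intro o
    induction o using WellFoundedLT.induction with
    | ind o ih =>
    intro w hw hD v hvK hvd hv
    have hHTw : HT w := by
      obtain ⟨s, ⟨hf, x, hxX, hxI, c, hc, hun, hpc, rfl⟩, hs⟩ := hDes2 w hD
      have hno : ∀ v, Relation.ReflTransGen Up x v → ¬ own v := by
        intro v hv ho
        rw [hown] at ho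
        obtain ⟨w, hw, hw'⟩ := ho
        exact hw' (hs w ⟨v, hv, hw⟩).1
      have hT' : ∀ v, Relation.ReflTransGen Up x v → Relation.ReflTransGen T x v := by
        intro v hv
        induction hv with
        | refl => exact .refl
        | @tail b c hb hbc ih => exact ih.tail ((hTd _ _).2 ⟨hbc, hno b hb⟩)
      exact (hHT w).2 ⟨x, hxX, hxI, (hIsTop _ _).2 ⟨c, hT' c hc,
        (hTopAt _ _).2 (Or.inr ⟨hno c hc, hun, hpc ▸ hf, hpc.symm⟩)⟩⟩
    obtain ⟨h1, h2, h3, h4⟩ := hξ w hHTw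
    obtain ⟨c, hc, hun, hpc, hside⟩ := h4 hD
    have upall : ∀ u, Relation.ReflTransGen Up (ξ w) u → Relation.ReflTransGen QU (ξ w) u →
        n u = p u := by
      intro u hu hq
      obtain ⟨huK, h | h⟩ := lemQ _ (hξK w hHTw) h2 u hq
      · exact h.2
      · exfalso
        have hs := hside u _ hu h
        exact ih _ (hw ▸ hs.2) (n u) rfl hs.1 u huK ((hSide _ _).1 h).2.2 rfl
    have hq : ∀ u, Relation.ReflTransGen Up (ξ w) u → Relation.ReflTransGen QU (ξ w) u := by
      intro u hu
      induction hu with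
      | refl => exact .refl
      | @tail b c hb hbc ih' => exact ih'.tail ((hQU _ _).2 ⟨hbc, upall b hb ih'⟩)
    have hcK := (lemQ _ (hξK w hHTw) h2 c (hq c hc)).1
    have : v = c := hn.1 hvK hcK (by rw [hv, upall c hc (hq c hc), hpc])
    subst this
    have := ((hUpN _).1 hun).2
    rw [hpc] at this
    omega
  have goUp : ∀ y, y ∈ K → y ∉ I → ∀ u, Relation.ReflTransGen QU y u → ¬ own u →
      UpN u ∧ n u = p u := by
    intro y hyK hyI u hu ho
    obtain ⟨huK, h | h⟩ := lemQ y hyK hyI u hu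
    · exact h
    · exfalso
      rw [hown] at ho
      push Not at ho
      exact claim1 _ (n u) rfl (ho _ h) u huK ((hSide _ _).1 h).2.2 rfl
  have tq : ∀ y, y ∈ K → y ∉ I → ∀ u, Relation.ReflTransGen T y u →
      Relation.ReflTransGen QU y u := by
    intro y hyK hyI u hu
    induction hu with
    | refl => exact .refl
    | @tail b c hb hbc ih =>
      have := (hTd _ _).1 hbc
      exact ih.tail ((hQU _ _).2 ⟨this.1, (goUp y hyK hyI b ih this.2).2⟩)
  have hxI : x ∉ I := fun h => hxJ (Or.inl h)
  -- the top of `x`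
  have hterm : ∃ t, Relation.ReflTransGen T x t ∧ ∀ b, ¬ T t b := by
    have : ∀ k u, d u = k → Relation.ReflTransGen T x u →
        ∃ t, Relation.ReflTransGen T x t ∧ ∀ b, ¬ T t b := by
      intro k
      induction k using Nat.strong_induction_on with
      | _ k ih =>
      intro u hk hu
      by_cases h : ∃ b, T u b
      · obtain ⟨b, hb⟩ := h
        exact ih (d b) (hk ▸ upDepth _ _ ((hTd _ _).1 hb).1) b rfl (hu.tail hb)
      · push Not at h
        exact ⟨u, hu, h⟩
    exact this _ x rfl .refl
  obtain ⟨t, hxt, htT⟩ := hterm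
  have htop : ∃ τ, TopAt t τ := by
    by_cases ho : own t
    · exact ⟨t, (hTopAt _ _).2 (Or.inl ⟨ho, rfl⟩)⟩
    · have hq := tq x hxK hxI t hxt
      obtain ⟨h1, h2⟩ := goUp x hxK hxI t hq ho
      have htK := (lemQ x hxK hxI t hq).1
      refine ⟨p t, (hTopAt _ _).2 (Or.inr ⟨ho, h1, (hFree _).2 ?_, rfl⟩)⟩
      intro v hvI hv
      by_cases hvd : d v < d (m v)
      · exact htT v ((hTd _ _).2 ⟨(hUp _ _).2 ⟨hvI, h1, hv, hvd⟩, ho⟩)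
      · have h1 := ndown v (hIK hvI) fun h => hvd (hAK v (hIK hvI) h).2
        have hmv : m v = p v := by
          rcases hp _ _ (hm.2 v hvI) with h | h
          · exact h.1
          · omega
        have : v = t := hn.1 (hIK hvI) htK (by rw [h1.2, h2, ← hv, hmv])
        subst this
        rcases Relation.ReflTransGen.cases_tail hxt with h | ⟨c, _, h⟩
        · exact hxI (h ▸ hvI)
        · exact hvd ((hUp _ _).1 ((hTd _ _).1 h).1).2.2.2
  obtain ⟨τ, hτ⟩ := htop
  have hHTτ : HT τ := (hHT τ).2 ⟨x, hKX hxK, hxI, (hIsTop _ _).2 ⟨t, hxt, hτ⟩⟩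
  obtain ⟨g1, g2, g3, _⟩ := hξ τ hHTτ
  obtain ⟨t', hxt', hτ'⟩ := (hIsTop _ _).1 g3
  have q1 := tq x hxK hxI t hxt
  have q2 := tq _ (hξK τ hHTτ) g2 t' hxt'
  have k1 := (lemQ x hxK hxI t q1).1
  have k2 := (lemQ _ (hξK τ hHTτ) g2 t' q2).1
  have htt : t = t' := by
    rcases (hTopAt _ _).1 hτ with ⟨_, h⟩ | ⟨ho, h1, _, h⟩ <;>
      rcases (hTopAt _ _).1 hτ' with ⟨_, h'⟩ | ⟨ho', h1', _, h'⟩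
    · rw [← h, ← h']
    · have := ((hUpN _).1 h1').1
      rw [← h', h] at this
      exact absurd this (hX _ (hKX k2) _ (hKX k1))
    · have := ((hUpN _).1 h1).1
      rw [← h, h'] at this
      exact absurd this (hX _ (hKX k1) _ (hKX k2))
    · apply hn.1 k1 k2
      rw [(goUp x hxK hxI t q1 ho).2, (goUp _ (hξK τ hHTτ) g2 t' q2 ho').2, ← h, ← h']
  subst htt
  have := origin x hxK hxI _ (hξK τ hHTτ) g2 t q1 q2
  exact hxJ (Or.inr ⟨τ, hHTτ, this⟩)

/-- For any tree `G` with vertex bipartition `(Vs, Ws)`, the subsets of `Vs`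
matchable into `Ws` form the independent sets of a matroid (in particular,
the maximality axiom (IM) holds). -/
theorem tree_transversal_matroid {α : Type*} (G : SimpleGraph α) (hT : G.IsTree)
    (Vs Ws : Set α)
    (hcover : ∀ a, a ∈ Vs ∨ a ∈ Ws) (hdisj : Disjoint Vs Ws)
    (hbip : ∀ a b, G.Adj a b → (a ∈ Vs ∧ b ∈ Ws) ∨ (a ∈ Ws ∧ b ∈ Vs)) :
    IsMatroidIndep (fun I : Set α =>
      I ⊆ Vs ∧ ∃ m : α → α, Set.InjOn m I ∧ ∀ v ∈ I, G.Adj v (m v)) := by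
  obtain ⟨p, d, hp⟩ := tt_root G hT
  refine ⟨⟨Set.empty_subset _, id, by simp, by simp⟩, ?_, ?_, ?_⟩
  · rintro I J hIJ ⟨hJ, m, h1, h2⟩
    exact ⟨hIJ.trans hJ, m, h1.mono hIJ, fun v hv => h2 v (hIJ hv)⟩
  · rintro I B hI hImax ⟨⟨hBV, n, hn⟩, hBmax⟩
    by_contra hcon
    apply hImax
    refine ⟨hI, ?_⟩
    rintro J ⟨hJV, m, hm⟩ hIJ
    refine Set.Subset.antisymm ?_ hIJ
    intro x hxJ
    by_contra hxI
    have hsub : insert x I ⊆ J := Set.insert_subset hxJ hIJ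
    obtain ⟨hxB, f, hf⟩ := tt_I3 G.Adj I B x m n
      ⟨hm.1.mono hsub, fun v hv => hm.2 v (hsub hv)⟩ hn hxI (by
        rintro b hb ⟨f, hf⟩
        exact hcon ⟨b, hb, Set.insert_subset (hBV hb.1) hI.1, f, hf⟩)
    have := hBmax (insert x B) ⟨Set.insert_subset (hJV hxJ) hBV, f, hf⟩ (Set.subset_insert _ _)
    exact hxB (this ▸ Set.mem_insert _ _)
  · rintro I0 X ⟨hI0V, m0, hm0⟩ hI0X
    have hXX : ∀ a ∈ X ∩ Vs, ∀ b ∈ X ∩ Vs, ¬ G.Adj a b := by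
      intro a ha b hb hab
      rcases hbip a b hab with h | h
      · exact Set.disjoint_left.1 hdisj hb.2 h.2
      · exact Set.disjoint_left.1 hdisj ha.2 h.1
    obtain ⟨I, m, hm, h1, h2, h3⟩ := tt_stageA G.Adj p d hp (X ∩ Vs) I0 m0 hm0
      (Set.subset_inter hI0X hI0V)
    obtain ⟨J, j, hj, h4, h5, h6⟩ := tt_stageB G.Adj p d hp (X ∩ Vs) hXX I m hm h2 h3
    refine ⟨J, ⟨fun v hv => (h5 hv).2, j, hj⟩, h1.trans h4, fun v hv => (h5 hv).1, ?_⟩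
    rintro K ⟨hKV, n, hn⟩ hKX hJK
    exact h6 K n hn (Set.subset_inter hKX hKV) hJK
end

section
/- Let (D, B_0) be a dimaze such that the underlying undirected graph of D is a tree, B_0 is one class of a bipartition of this tree, and all edges of D are directed towards B_0. Then M_L(D, B_0) is a matroid, and it is isomorphic to the transversal set system M_T(G) of the tree G obtained from the underlying graph of D by attaching to each vertex b ∈ B_0 a new leaf b' and taking the bipartition ((V(D) \ B_0) ∪ B_0', B_0), where B_0' is the set of new leaves. -/
open Set

universe u

variable {V : Type*}

/-- Bipartite matchability. -/
def Matchable {α β : Type*} (E : α → β → Prop) (I : Set α) : Prop :=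
  ∃ m : α → β, Set.InjOn m I ∧ ∀ v ∈ I, E v (m v)

/-- The bipartite (tree) relation of the graph `G` obtained from the underlying
tree of `D` by attaching to each `b ∈ B0` a new leaf copy `b'`:
left class `(V \ B0) ∪ B0'`, right class `B0`. -/
def TreeRel (D : V → V → Prop) (B0 : Set V) : V ⊕ V → V → Prop
  | Sum.inl v, w => w ∈ B0 ∧ (D v w ∨ D w v)
  | Sum.inr b, w => b ∈ B0 ∧ w = b

/-- The left class of the bipartition of `G`: the original non-exit vertices
together with the copies of the exits. -/
def TreeGround (B0 : Set V) : Set (V ⊕ V) :=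
  (Sum.inl '' B0ᶜ) ∪ (Sum.inr '' B0)

namespace TreeAux

/-- certificate of non-augmentability -/
inductive Dead {α β : Type*} (E : α → β → Prop) (m : α → β) (J : Set α) : α → Prop
  | mk0 (v : α) (S : Set α) (hS : ∀ u ∈ S, Dead E m J u)
      (h : ∀ w, E v w → (v ∈ J ∧ m v = w) ∨ ∃ u, u ∈ J ∧ m u = w ∧ u ∈ S) :
      Dead E m J v

theorem Dead.mk {α β : Type*} {E : α → β → Prop} {m : α → β} {J : Set α} (v : α)
    (h : ∀ w, E v w → (v ∈ J ∧ m v = w) ∨ ∃ u, u ∈ J ∧ m u = w ∧ Dead E m J u) :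
    Dead E m J v := Dead.mk0 v {u | Dead E m J u} (fun _ h => h) h

theorem dead_fixed {α β : Type*} {E : α → β → Prop} {m n : α → β} {J K : Set α}
    (hJK : J ⊆ K) (hn : Set.InjOn n K) (hnE : ∀ v ∈ K, E v (n v)) {v : α}
    (hv : Dead E m J v) : v ∈ K → v ∈ J ∧ n v = m v := by
  induction hv with
  | mk0 v S hS h ih =>
    intro hvK
    rcases h (n v) (hnE v hvK) with ⟨h1, h2⟩ | ⟨u, hu, hmu, hd⟩
    · exact ⟨h1, h2.symm⟩
    · have h3 := ih u hd (hJK hu)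
      have : u = v := hn (hJK hu) hvK (h3.2.trans hmu)
      subst this
      exact h3

theorem exchange {α β : Type*} {E : α → β → Prop} {m n mB : α → β} {I B : Set α} {y : α}
    (hy : y ∉ I) (hmI : Set.InjOn m I)
    (hn : Set.InjOn n (insert y I)) (hnE : ∀ v ∈ insert y I, E v (n v))
    (hB : Set.InjOn mB B) (hBE : ∀ v ∈ B, E v (mB v))
    (hdead : ∀ x ∈ B, x ∉ I → Dead E m I x) :
    y ∉ B ∧ Matchable E (insert y B) := by
  classical
  have hyd : ¬ Dead E m I y := fun h =>
    hy (dead_fixed (Set.subset_insert y I) hn hnE h (Set.mem_insert y I)).1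
  have key : ∀ v ∈ B, Dead E m I v → ∀ v' ∈ insert y I, ¬ Dead E m I v' → mB v ≠ n v' := by
    intro v hv hd v' hv' hd' he
    have : ∃ u, u ∈ I ∧ m u = mB v ∧ Dead E m I u := by
      cases hd with
      | mk0 _ S hS h =>
        rcases h _ (hBE v hv) with ⟨h1, h2⟩ | ⟨u, h1, h2, h3⟩
        · exact ⟨v, h1, h2, Dead.mk0 _ S hS h⟩
        · exact ⟨u, h1, h2, hS u h3⟩
    obtain ⟨u, hu, hmu, hdu⟩ := this
    have h3 := dead_fixed (Set.subset_insert y I) hn hnE hdu (Set.mem_insert_of_mem y hu)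
    have : u = v' := hn (Set.mem_insert_of_mem y hu) hv' (h3.2.trans (hmu.trans he))
    exact hd' (this ▸ hdu)
  have hin : ∀ v ∈ insert y B, ¬ Dead E m I v → v ∈ insert y I := by
    intro v hv hd
    rcases hv with rfl | hv
    · exact Set.mem_insert _ _
    · by_cases h : v ∈ I
      · exact Set.mem_insert_of_mem _ h
      · exact absurd (hdead v hv h) hd
  have hin' : ∀ v ∈ insert y B, Dead E m I v → v ∈ B := by
    intro v hv hd
    rcases hv with rfl | hv
    · exact absurd hd hyd
    · exact hv
  refine ⟨fun h => hyd (hdead y h hy), fun v => if Dead E m I v then mB v else n v, ?_, ?_⟩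
  · intro a ha b hb hab
    by_cases h1 : Dead E m I a <;> by_cases h2 : Dead E m I b <;> simp only [h1, h2, if_true, if_false] at hab
    · exact hB (hin' a ha h1) (hin' b hb h2) hab
    · exact absurd hab (key a (hin' a ha h1) h1 b (hin b hb h2) h2)
    · exact absurd hab.symm (key b (hin' b hb h2) h2 a (hin a ha h1) h1)
    · exact hn (hin a ha h1) (hin b hb h2) hab
  · intro a ha
    by_cases h1 : Dead E m I a <;> simp only [h1, if_true, if_false]
    · exact hBE a (hin' a ha h1)
    · exact hnE a (hin a ha h1)

section rooted
variable {α β : Type*}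

/-- blocked vertices, graded -/
inductive BlR (C P : α → β → Prop) (X : Set α) : Ordinal.{u} → α → Prop
  | mk (o : Ordinal.{u}) (v : α) (S : Ordinal.{u} → Set α)
      (hS : ∀ o', ∀ u ∈ S o', BlR C P X o' u)
      (h : ∀ w, C v w → ∃ u, u ∈ X ∧ P u w ∧ ∃ o', o' < o ∧ u ∈ S o') : BlR C P X o v

/-- vertices all of whose downward alternating paths die -/
inductive Dn (C P : α → β → Prop) (J : Set α) (m : α → β) : α → Prop
  | mk0 (v : α) (S : Set α) (hS : ∀ u ∈ S, Dn C P J m u)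
      (h : ∀ w, C v w → ∃ u, u ∈ J ∧ P u w ∧ m u = w ∧ u ∈ S) : Dn C P J m v

theorem Dn.mk {C P : α → β → Prop} {J : Set α} {m : α → β} (v : α)
    (h : ∀ w, C v w → ∃ u, u ∈ J ∧ P u w ∧ m u = w ∧ Dn C P J m u) : Dn C P J m v :=
  Dn.mk0 v {u | Dn C P J m u} (fun _ h => h) h

/-- the right vertices to be re-matched -/
inductive Zs (U : β → Prop) (I : Set α) (m : α → β) (c : β → α) : β → Prop
  | base (w : β) (hU : U w) (h : ∀ v ∈ I, m v ≠ w) : Zs U I m c w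
  | step (w : β) (h : Zs U I m c w) (hc : c w ∈ I) : Zs U I m c (m (c w))

end rooted

theorem exists_rank {α : Type*} {β : Type u} (C P : α → β → Prop) (X : Set α) :
    ∃ (Bl : α → Prop) (rk : α → Ordinal.{u}),
      (∀ v, Bl v ↔ ∀ w, C v w → ∃ u, u ∈ X ∧ P u w ∧ Bl u) ∧
      (∀ v, Bl v → ∀ w, C v w → ∃ u, u ∈ X ∧ P u w ∧ Bl u ∧ rk u < rk v) := by
  classical
  have h2 : ∀ v, (∃ o : Ordinal.{u}, BlR C P X o v) → ∀ w, C v w → ∃ u, u ∈ X ∧ P u w ∧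
      (∃ o : Ordinal.{u}, BlR C P X o u) ∧
        sInf {o : Ordinal.{u} | BlR C P X o u} < sInf {o : Ordinal.{u} | BlR C P X o v} := by
    intro v hv w hw
    have hmem : BlR C P X (sInf {o : Ordinal.{u} | BlR C P X o v}) v :=
      csInf_mem (s := {o : Ordinal.{u} | BlR C P X o v}) hv
    generalize sInf {o : Ordinal.{u} | BlR C P X o v} = o at hmem
    cases hmem with
    | mk _ _ S hS h =>
      obtain ⟨x, hx, hP, o', ho', hb'⟩ := h w hw
      have hb := hS _ _ hb'
      exact ⟨x, hx, hP, ⟨o', hb⟩, lt_of_le_of_lt (csInf_le' hb) ho'⟩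
  refine ⟨fun v => ∃ o : Ordinal.{u}, BlR C P X o v, fun v => sInf {o | BlR C P X o v}, ?_, h2⟩
  intro v
  constructor
  · intro hv w hw
    obtain ⟨x, a, b, c, -⟩ := h2 v hv w hw
    exact ⟨x, a, b, c⟩
  · intro h
    have hne : Nonempty α := ⟨v⟩
    choose! f hf1 hf2 hf3 using h
    choose! o ho using hf3
    refine ⟨⨆ w, o w + 1, BlR.mk _ _ (fun o' => {u | BlR C P X o' u}) (fun _ _ h => h)
      fun w hw => ⟨f w, hf1 w hw, hf2 w hw, o w, ?_, ho w hw⟩⟩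
    exact Ordinal.lt_iSup_add_one o w

theorem extend {α : Type*} {β : Type u} (C P : α → β → Prop) (d : α → ℕ)
    (hC : ∀ v v' w, C v w → C v' w → v = v') (hP : ∀ v w w', P v w → P v w' → w = w')
    (hd : ∀ v u w, P v w → C u w → d u < d v)
    (X I : Set α) (hIX : I ⊆ X) (m0 : α → β) (hm0 : Set.InjOn m0 I)
    (hm0E : ∀ v ∈ I, C v (m0 v) ∨ P v (m0 v)) :
    ∃ (J : Set α) (m : α → β), I ⊆ J ∧ J ⊆ X ∧ Set.InjOn m J ∧
      (∀ v ∈ J, C v (m v) ∨ P v (m v)) ∧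
      ∀ y ∈ X, y ∉ J → Dead (fun v w => C v w ∨ P v w) m J y := by
  classical
  have hdisj : ∀ v w, C v w → P v w → False := fun v w h1 h2 => lt_irrefl _ (hd v v w h2 h1)
  obtain ⟨Bl, rk, hBl, hrk⟩ := exists_rank C P X
  set U : β → Prop := fun w => ∃ u, u ∈ X ∧ P u w ∧ Bl u with hU
  -- the choice of minimal rank
  have hc : ∀ w, U w → ∃ x, x ∈ X ∧ P x w ∧ Bl x ∧ ∀ u, u ∈ X → P u w → Bl u → rk x ≤ rk u := by
    rintro w ⟨x, hx⟩
    have hne : {u | u ∈ X ∧ P u w ∧ Bl u}.Nonempty := ⟨x, hx⟩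
    have hz := Function.argminOn_mem rk {u | u ∈ X ∧ P u w ∧ Bl u} hne
    exact ⟨_, hz.1, hz.2.1, hz.2.2, fun u a b c =>
      Function.argminOn_le rk {u | u ∈ X ∧ P u w ∧ Bl u} (a := u) ⟨a, b, c⟩⟩
  by_cases hne : Nonempty α
  swap
  · refine ⟨I, m0, subset_rfl, hIX, hm0, hm0E, fun y => absurd ⟨y⟩ hne⟩
  choose! c hcX hcP hcB hcmin using hc
  have hcrk : ∀ v w, Bl v → C v w → rk (c w) < rk v := by
    intro v w hv hw
    obtain ⟨x, h1, h2, h3, h4⟩ := hrk v hv w hw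
    exact lt_of_le_of_lt (hcmin w ⟨x, h1, h2, h3⟩ x h1 h2 h3) h4
  have hUC : ∀ v w, Bl v → C v w → U w := fun v w hv hw => (hBl v).1 hv w hw
  -- children of nonblocked vertices
  have hg : ∀ v, ¬ Bl v → ∃ w, C v w ∧ ¬ U w := by
    intro v hv
    by_contra hcon
    push Not at hcon
    exact hv ((hBl v).2 hcon)
  by_cases hneb : Nonempty β
  swap
  · refine ⟨X, m0, hIX, subset_rfl, ?_, ?_, fun y h h' => absurd h h'⟩
    · intro a; exact absurd ⟨m0 a⟩ hneb
    · intro a; exact absurd ⟨m0 a⟩ hneb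
  choose! g hgC hgU using hg
  set Ib : Set α := {v | v ∈ I ∧ Bl v} with hIb
  -- the shift
  have hf : ∀ v, ¬ Dn C P Ib m0 v →
      ∃ w, C v w ∧ ∀ u, u ∈ Ib → P u w → m0 u = w → ¬ Dn C P Ib m0 u := by
    intro v hv
    by_contra hcon
    push Not at hcon
    exact hv (Dn.mk v fun w hw => by
      obtain ⟨x, h1, h2, h3, h4⟩ := hcon w hw
      exact ⟨x, h1, h2, h3, h4⟩)
  choose! f hfC hfN using hf
  obtain ⟨m1, hm1s, hm1n⟩ : ∃ m1 : α → β,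
      (∀ v, (P v (m0 v) ∧ ¬ Dn C P Ib m0 v) → m1 v = f v) ∧
      (∀ v, ¬ (P v (m0 v) ∧ ¬ Dn C P Ib m0 v) → m1 v = m0 v) :=
    ⟨fun v => if P v (m0 v) ∧ ¬ Dn C P Ib m0 v then f v else m0 v,
      fun v h => if_pos h, fun v h => if_neg h⟩
  have hm1E : ∀ v ∈ Ib, C v (m1 v) ∨ P v (m1 v) := by
    intro v hv
    by_cases h : P v (m0 v) ∧ ¬ Dn C P Ib m0 v
    · rw [hm1s v h]; exact Or.inl (hfC v h.2)
    · rw [hm1n v h]; exact hm0E v hv.1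
  have hEU : ∀ v w, v ∈ X → Bl v → (C v w ∨ P v w) → U w := by
    rintro v w hvX hv (h | h)
    · exact hUC v w hv h
    · exact ⟨v, hvX, h, hv⟩
  have hm1U : ∀ v ∈ Ib, U (m1 v) := fun v hv => hEU v _ (hIX hv.1) hv.2 (hm1E v hv)
  have haux : ∀ v ∈ Ib, ∀ v' ∈ Ib, (P v (m0 v) ∧ ¬ Dn C P Ib m0 v) →
      ¬ (P v' (m0 v') ∧ ¬ Dn C P Ib m0 v') → f v ≠ m0 v' := by
    intro v hv v' hv' h h' he
    have hfv := hfC v h.2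
    rcases hm0E v' hv'.1 with h1 | h1
    · rw [← he] at h1
      have := hC _ _ _ hfv h1
      subst this
      rw [he] at hfv
      exact hdisj _ _ hfv h.1
    · exact h' ⟨h1, hfN v h.2 v' hv' (he ▸ h1) he.symm⟩
  have hm1inj : Set.InjOn m1 Ib := by
    intro a ha b hb hab
    by_cases h1 : P a (m0 a) ∧ ¬ Dn C P Ib m0 a <;> by_cases h2 : P b (m0 b) ∧ ¬ Dn C P Ib m0 b
    · rw [hm1s a h1, hm1s b h2] at hab
      have h3 := hfC a h1.2
      rw [hab] at h3
      exact hC _ _ _ h3 (hfC b h2.2)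
    · rw [hm1s a h1, hm1n b h2] at hab
      exact absurd hab (haux a ha b hb h1 h2)
    · rw [hm1n a h1, hm1s b h2] at hab
      exact absurd hab.symm (haux b hb a ha h2 h1)
    · rw [hm1n a h1, hm1n b h2] at hab
      exact hm0 ha.1 hb.1 hab
  have hm1up : ∀ v ∈ Ib, P v (m1 v) → Dn C P Ib m0 v := by
    intro v hv h
    by_contra hcon
    by_cases h1 : P v (m0 v)
    · rw [hm1s v ⟨h1, hcon⟩] at h
      exact hdisj _ _ (hfC v hcon) h
    · rw [hm1n v (fun h' => h1 h'.1)] at h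
      exact h1 h
  -- re-matching
  set Z := Zs U Ib m1 c with hZ
  have hZU : ∀ w, Z w → U w := by
    intro w hw
    cases hw with
    | base _ h _ => exact h
    | step w h hc => exact hm1U _ hc
  obtain ⟨m, hmg, hmz, hmo⟩ : ∃ m : α → β, (∀ v, ¬ Bl v → m v = g v) ∧
      (∀ w, Z w → m (c w) = w) ∧ (∀ v, Bl v → (∀ w, Z w → c w ≠ v) → m v = m1 v) := by
    refine ⟨fun v => if h : Bl v then (if h' : ∃ w, Z w ∧ c w = v then h'.choose else m1 v)
      else g v, ?_, ?_, ?_⟩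
    · intro v h; simp [h]
    · intro w hw
      have h1 : Bl (c w) := hcB w (hZU w hw)
      have h2 : ∃ w', Z w' ∧ c w' = c w := ⟨w, hw, rfl⟩
      simp only [h1, h2, dif_pos]
      obtain ⟨h3, h4⟩ := h2.choose_spec
      have h5 := hcP _ (hZU _ h3)
      rw [h4] at h5
      exact hP _ _ _ h5 (hcP w (hZU w hw))
    · intro v h h'
      have : ¬ ∃ w, Z w ∧ c w = v := by rintro ⟨w, a, b⟩; exact h' w a b
      simp only [h, this, dif_pos, dif_neg, not_false_eq_true]
  set J : Set α := {v | (v ∈ X ∧ ¬ Bl v) ∨ v ∈ Ib ∨ ∃ w, Z w ∧ c w = v} with hJ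
  have hIJ : I ⊆ J := by
    intro v hv
    by_cases h : Bl v
    · exact Or.inr (Or.inl ⟨hv, h⟩)
    · exact Or.inl ⟨hIX hv, h⟩
  have hJX : J ⊆ X := by
    rintro v (h | h | ⟨w, h, rfl⟩)
    · exact h.1
    · exact hIX h.1
    · exact hcX w (hZU w h)
  -- the trichotomy
  have htri : ∀ v ∈ J, (¬ Bl v ∧ m v = g v) ∨ (Bl v ∧ Z (m v) ∧ c (m v) = v) ∨
      (Bl v ∧ v ∈ Ib ∧ m v = m1 v ∧ ∀ w, Z w → c w ≠ v) := by
    intro v hv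
    by_cases hb : Bl v
    · right
      by_cases hs : ∃ w, Z w ∧ c w = v
      · obtain ⟨w, hw, rfl⟩ := hs
        left
        rw [hmz w hw]
        exact ⟨hb, hw, rfl⟩
      · right
        have hs' : ∀ w, Z w → c w ≠ v := fun w a b => hs ⟨w, a, b⟩
        rcases hv with h | h | h
        · exact absurd hb h.2
        · exact ⟨hb, h, hmo v hb hs', hs'⟩
        · exact absurd h hs
    · exact Or.inl ⟨hb, hmg v hb⟩
  have hmE : ∀ v ∈ J, C v (m v) ∨ P v (m v) := by
    intro v hv
    rcases htri v hv with ⟨h1, h2⟩ | ⟨h1, h2, h3⟩ | ⟨h1, h2, h3, h4⟩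
    · rw [h2]; exact Or.inl (hgC v h1)
    · right
      have := hcP _ (hZU _ h2)
      rwa [h3] at this
    · rw [h3]; exact hm1E v h2
  have hmU : ∀ v ∈ J, Bl v → U (m v) := fun v hv hb => hEU v _ (hJX hv) hb (hmE v hv)
  have haux2 : ∀ v v', v ∈ Ib → m v = m1 v → (∀ w, Z w → c w ≠ v) → Z (m v') → m v ≠ m v' := by
    intro v v' hv hmv hs hz he
    rw [← he, hmv] at hz
    generalize hw : m1 v = w at hz
    cases hz with
    | base _ hU h => exact h v hv hw
    | step w' h hc => exact hs w' h (hm1inj hc hv hw.symm)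
  have hminj : Set.InjOn m J := by
    intro a ha b hb hab
    rcases htri a ha with ⟨h1, h2⟩ | ⟨h1, h2, h3⟩ | ⟨h1, h2, h3, h4⟩ <;>
    rcases htri b hb with ⟨k1, k2⟩ | ⟨k1, k2, k3⟩ | ⟨k1, k2, k3, k4⟩
    · have h5 := hgC a h1
      rw [← h2, hab, k2] at h5
      exact hC _ _ _ h5 (hgC b k1)
    · exact absurd (hmU b hb k1) (by rw [← hab, h2]; exact hgU a h1)
    · exact absurd (hmU b hb k1) (by rw [← hab, h2]; exact hgU a h1)
    · exact absurd (hmU a ha h1) (by rw [hab, k2]; exact hgU b k1)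
    · rw [← h3, ← k3, hab]
    · exact absurd hab.symm (haux2 b a k2 k3 k4 h2)
    · exact absurd (hmU a ha h1) (by rw [hab, k2]; exact hgU b k1)
    · exact absurd hab (haux2 a b h2 h3 h4 k2)
    · rw [h3, k3] at hab
      exact hm1inj h2 k2 hab
  have hcov : ∀ w, U w → ∃ v, v ∈ J ∧ Bl v ∧ m v = w := by
    intro w hw
    by_cases hz : Z w
    · exact ⟨c w, Or.inr (Or.inr ⟨w, hz, rfl⟩), hcB w hw, hmz w hz⟩
    · have : ∃ v ∈ Ib, m1 v = w := by
        by_contra hcon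
        push Not at hcon
        exact hz (Zs.base w hw hcon)
      obtain ⟨v, hv, hvw⟩ := this
      refine ⟨v, Or.inr (Or.inl hv), hv.2, ?_⟩
      rw [hmo v hv.2, hvw]
      intro w' hw' hcw
      apply hz
      have := Zs.step w' hw' (hcw.symm ▸ hv)
      rwa [hcw, hvw] at this
  -- Claim A
  have hA : ∀ v, Dn C P Ib m0 v → Dn C P J m v := by
    intro v hv
    induction hv with
    | mk0 v S hS h ih =>
      refine Dn.mk v fun w hw => ?_
      obtain ⟨x, hx, hxP, hxm, hxd, hi⟩ : ∃ u, u ∈ Ib ∧ P u w ∧ m0 u = w ∧ Dn C P Ib m0 u ∧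
          Dn C P J m u := by
        obtain ⟨x, h1, h2, h3, h4⟩ := h w hw
        exact ⟨x, h1, h2, h3, hS x h4, ih x h4⟩
      have hxJ : x ∈ J := Or.inr (Or.inl hx)
      refine ⟨x, hxJ, hxP, ?_, hi⟩
      rcases htri x hxJ with ⟨h1, h2⟩ | ⟨h1, h2, h3⟩ | ⟨h1, h2, h3, h4⟩
      · exact absurd hx.2 h1
      · have := hcP _ (hZU _ h2)
        rw [h3] at this
        exact hP _ _ _ this hxP
      · rw [h3, hm1n x (fun h' => h'.2 hxd), hxm]
  -- Claim B
  have hB : ∀ o : Ordinal.{u}, ∀ v, rk v = o → Bl v → ¬ (v ∈ J ∧ C v (m v)) → Dn C P J m v := by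
    intro o
    induction o using WellFoundedLT.induction with
    | ind o ih =>
      intro v hvo hv hnc
      refine Dn.mk v fun w hw => ?_
      obtain ⟨x, hxJ, hxB, hxm⟩ := hcov w (hUC v w hv hw)
      have hxP : P x w := by
        rcases hmE x hxJ with h | h
        · exfalso
          rw [hxm] at h
          have := hC _ _ _ hw h
          subst this
          exact hnc ⟨hxJ, by rw [hxm]; exact h⟩
        · rwa [hxm] at h
      refine ⟨x, hxJ, hxP, hxm, ?_⟩
      rcases htri x hxJ with ⟨h1, h2⟩ | ⟨h1, h2, h3⟩ | ⟨h1, h2, h3, h4⟩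
      · exact absurd hxB h1
      · refine ih (rk x) ?_ x rfl hxB (fun h => hdisj x w ?_ hxP)
        · rw [← h3, hxm, ← hvo]; exact hcrk v w hv hw
        · rw [← hxm]; exact h.2
      · apply hA
        apply hm1up x h2
        rw [← h3, hxm]; exact hxP
  -- Claim C
  have hup : ∀ v, Dn C P J m v → v ∈ J → P v (m v) →
      Dead (fun v w => C v w ∨ P v w) m J v := by
    intro v hv
    induction hv with
    | mk0 v S hS h ih =>
      intro hvJ hvP
      refine Dead.mk v fun w hw => ?_
      rcases hw with hw | hw
      · right
        obtain ⟨x, h1, h2, h3, h4⟩ := h w hw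
        exact ⟨x, h1, h3, ih x h4 h1 (h3.symm ▸ h2)⟩
      · left
        exact ⟨hvJ, hP _ _ _ hvP hw⟩
  have hup' : ∀ v, v ∈ J → Bl v → P v (m v) → Dead (fun v w => C v w ∨ P v w) m J v :=
    fun v h1 h2 h3 => hup v (hB _ v rfl h2 (fun h => hdisj _ _ h.2 h3)) h1 h3
  have hdead : ∀ k : ℕ, ∀ v, d v = k → v ∈ X → Bl v → Dead (fun v w => C v w ∨ P v w) m J v := by
    intro k
    induction k using Nat.strong_induction_on with
    | _ k ih =>
      intro v hk hvX hvB
      refine Dead.mk v fun w hw => ?_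
      obtain ⟨x, hxJ, hxB, hxm⟩ := hcov w (hEU v w hvX hvB hw)
      by_cases hxv : x = v
      · subst hxv; exact Or.inl ⟨hxJ, hxm⟩
      right
      refine ⟨x, hxJ, hxm, ?_⟩
      rcases hmE x hxJ with h | h
      · rw [hxm] at h
        rcases hw with hw | hw
        · exact absurd (hC _ _ _ h hw) hxv
        · exact ih (d x) (hk ▸ hd v x w hw h) x rfl (hJX hxJ) hxB
      · exact hup' x hxJ hxB h
  refine ⟨J, m, hIJ, hJX, hminj, hmE, fun y hy hyJ => hdead _ y rfl hy ?_⟩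
  by_contra hb
  exact hyJ (Or.inl ⟨hy, hb⟩)

theorem matroid_of_rooted {α : Type*} {β : Type u} (C P : α → β → Prop) (d : α → ℕ) [Nonempty β]
    (hC : ∀ v v' w, C v w → C v' w → v = v') (hP : ∀ v w w', P v w → P v w' → w = w')
    (hd : ∀ v u w, P v w → C u w → d u < d v) :
    IsMatroidIndep (Matchable (fun v w => C v w ∨ P v w)) := by
  refine ⟨⟨fun _ => Classical.arbitrary β, by simp, by simp⟩, ?_, ?_, ?_⟩
  · rintro I J hIJ ⟨m, h1, h2⟩
    exact ⟨m, h1.mono hIJ, fun v hv => h2 v (hIJ hv)⟩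
  · rintro I B ⟨m0, hm0, hm0E⟩ hI ⟨⟨mB, hB, hBE⟩, hmax⟩
    obtain ⟨J, m, hIJ, hJX, hm, hmE, hdead⟩ :=
      extend C P d hC hP hd (I ∪ B) I Set.subset_union_left m0 hm0 hm0E
    by_cases hJI : J ⊆ I
    · have : J = I := hJI.antisymm hIJ
      subst this
      exfalso
      apply hI
      refine ⟨⟨m0, hm0, hm0E⟩, ?_⟩
      rintro K ⟨n, hn, hnE⟩ hJK
      by_contra hne
      obtain ⟨y, hyK, hyJ⟩ : ∃ y ∈ K, y ∉ J := by
        by_contra hcon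
        push Not at hcon
        exact hne (Set.Subset.antisymm hcon hJK)
      have hsub : insert y J ⊆ K := Set.insert_subset hyK hJK
      obtain ⟨h1, h2⟩ := exchange (E := fun v w => C v w ∨ P v w) hyJ hm (hn.mono hsub) (fun v hv => hnE v (hsub hv)) hB hBE
        (fun x hx hxJ => hdead x (Or.inr hx) hxJ)
      have := hmax _ h2 (Set.subset_insert y B)
      exact h1 (this ▸ Set.mem_insert y B)
    · obtain ⟨x, hxJ, hxI⟩ := Set.not_subset.1 hJI
      have hsub : insert x I ⊆ J := Set.insert_subset hxJ hIJ
      refine ⟨x, ⟨(hJX hxJ).resolve_left hxI, hxI⟩, m, hm.mono hsub, fun v hv => hmE v (hsub hv)⟩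
  · rintro I X ⟨m0, hm0, hm0E⟩ hIX
    obtain ⟨J, m, hIJ, hJX, hm, hmE, hdead⟩ := extend C P d hC hP hd X I hIX m0 hm0 hm0E
    refine ⟨J, ⟨m, hm, hmE⟩, hIJ, hJX, ?_⟩
    rintro K ⟨n, hn, hnE⟩ hKX hJK
    refine Set.Subset.antisymm (fun y hy => ?_) hJK
    by_contra hyJ
    exact hyJ (dead_fixed (E := fun v w => C v w ∨ P v w) hJK hn hnE (hdead y (hKX hy) hyJ) hy).1

theorem parent_unique {V : Type*} {G : SimpleGraph V} (hG : G.IsTree) (r : V) {x u u' : V}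
    (h1 : G.Adj u x) (h2 : G.Adj u' x) (d1 : G.dist r x = G.dist r u + 1)
    (d2 : G.dist r x = G.dist r u' + 1) : u = u' := by
  obtain ⟨p, hp, hpl⟩ := hG.1.exists_path_of_dist r u
  obtain ⟨q, hq, hql⟩ := hG.1.exists_path_of_dist r u'
  have e1 : (p.concat h1).length = G.dist r x := by simp [hpl, d1]
  have e2 : (q.concat h2).length = G.dist r x := by simp [hql, d2]
  have := (hG.existsUnique_path r x).unique (SimpleGraph.Walk.isPath_of_length_eq_dist _ e1)
    (SimpleGraph.Walk.isPath_of_length_eq_dist _ e2)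
  have h3 := congrArg SimpleGraph.Walk.penultimate this
  simpa using h3

theorem linkable_iff {V : Type*} (D : V → V → Prop) (B0 : Set V) (hD : IsDimaze D B0)
    (hdir : ∀ a b, D a b → b ∈ B0 ∧ a ∉ B0) (I : Set V) :
    Linkable D B0 I ↔ Matchable (fun v w => (v ∈ B0 ∧ w = v) ∨ D v w) I := by
  classical
  constructor
  · rintro ⟨P, ⟨hP1, hP2⟩, rfl⟩
    have h : ∀ v : V, v ∈ Ini P → ∃ p : DiPath D, p ∈ P ∧ p.first = v := fun v hv => hv
    by_cases hne : (Ini P).Nonempty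
    swap
    · rw [Set.not_nonempty_iff_eq_empty] at hne
      rw [hne]
      exact ⟨id, by simp, by simp⟩
    obtain ⟨v0, hv0⟩ := hne
    haveI : Nonempty (DiPath D) := ⟨(h v0 hv0).choose⟩
    choose! p hp hpf using h
    refine ⟨fun v => (p v).last, ?_, ?_⟩
    · intro a ha b hb hab
      by_contra hne
      have hpne : p a ≠ p b := fun he => hne (by rw [← hpf a ha, ← hpf b hb, he])
      have := hP2 _ (hp a ha) _ (hp b hb) hpne
      rw [Set.disjoint_left] at this
      refine @this (p a).last (List.getLast_mem _) ?_
      have hab' : (p a).last = (p b).last := hab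
      rw [hab']
      exact List.getLast_mem _
    · intro v hv
      have h1 := hP1 _ (hp v hv)
      have h2 := hpf v hv
      show (v ∈ B0 ∧ (p v).last = v) ∨ D v (p v).last
      generalize p v = q at h1 h2 ⊢
      obtain ⟨l, hl, hnd, hch⟩ := q
      simp only [DiPath.first, DiPath.last] at *
      match l, hl, hch with
      | [a], _, _ =>
        simp at h1 h2
        subst h2
        left; simpa using h1
      | [a, b], _, hch =>
        have hch' : List.IsChain D [a, b] := hch
        simp at h1 h2 hch'
        subst h2
        right; simpa using hch'
      | a :: b :: c :: l, _, hch =>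
        exfalso
        have hch' : List.IsChain D (a :: b :: c :: l) := hch
        rw [List.isChain_cons_cons, List.isChain_cons_cons] at hch'
        exact hD b (hdir _ _ hch'.1).1 c hch'.2.1
  · rintro ⟨m, hm, hmE⟩
    have hpath : ∀ v ∈ I, ∃ p : DiPath D, p.first = v ∧ p.last = m v ∧
        ∀ x ∈ p.vertSet, x = v ∨ x = m v := by
      intro v hv
      rcases hmE v hv with ⟨h1, h2⟩ | h
      · exact ⟨⟨[v], by simp, by simp, List.isChain_singleton v⟩, by simp [DiPath.first],
          by simp [DiPath.last, h2], by simp [DiPath.vertSet, h2]⟩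
      · have hne : v ≠ m v := fun he => (hdir _ _ h).2 (by
          have := (hdir _ _ h).1
          rwa [← he] at this)
        exact ⟨⟨[v, m v], by simp, by simp [hne], List.isChain_pair.2 h⟩, by simp [DiPath.first],
          by simp [DiPath.last], by simp [DiPath.vertSet]⟩
    have hmB : ∀ v ∈ I, m v ∈ B0 := by
      intro v hv
      rcases hmE v hv with ⟨h1, h2⟩ | h
      · rwa [h2]
      · exact (hdir _ _ h).1
    have hfix : ∀ v ∈ I, v ∈ B0 → m v = v := by
      intro v hv hb
      rcases hmE v hv with ⟨h1, h2⟩ | h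
      · exact h2
      · exact absurd h (hD v hb _)
    by_cases hne : I.Nonempty
    swap
    · rw [Set.not_nonempty_iff_eq_empty] at hne
      subst hne
      exact ⟨∅, ⟨by simp, by simp⟩, by simp [Ini]⟩
    obtain ⟨v0, hv0⟩ := hne
    haveI : Nonempty (DiPath D) := ⟨(hpath v0 hv0).choose⟩
    choose! p hpf hpl hpv using hpath
    refine ⟨p '' I, ⟨?_, ?_⟩, ?_⟩
    · rintro _ ⟨v, hv, rfl⟩
      rw [hpl v hv]; exact hmB v hv
    · rintro _ ⟨v, hv, rfl⟩ _ ⟨v', hv', rfl⟩ hne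
      rw [Set.disjoint_left]
      intro x hx hx'
      apply hne
      suffices v = v' by rw [this]
      rcases hpv v hv x hx with rfl | rfl <;> rcases hpv v' hv' _ hx' with h | h
      · exact h
      · apply hm hv hv'
        rw [← h]
        exact hfix x hv (h ▸ hmB v' hv')
      · apply hm hv hv'
        have : v' ∈ B0 := h ▸ hmB v hv
        rw [hfix v' hv' this, h]
      · exact hm hv hv' h
    · ext v
      constructor
      · rintro ⟨_, ⟨v', hv', rfl⟩, rfl⟩
        rw [hpf v' hv']; exact hv'
      · intro hv
        exact ⟨p v, ⟨v, hv, rfl⟩, hpf v hv⟩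

end TreeAux

/-- If the underlying graph of a dimaze is a tree with bipartition class `B0` and
all edges directed towards `B0`, then the linkability system is a matroid, and it
is isomorphic to the transversal set system of the tree obtained by attaching a
new leaf to each exit. -/
theorem tree_dimaze_matroid (D : V → V → Prop) (B0 : Set V) (hD : IsDimaze D B0)
    (htree : (SimpleGraph.fromRel D).IsTree)
    (hdir : ∀ a b, D a b → b ∈ B0 ∧ a ∉ B0) :
    IsMatroidIndep (Linkable D B0) ∧
    ∃ φ : V → V ⊕ V, Function.Injective φ ∧ Set.range φ = TreeGround B0 ∧
      ∀ I : Set V, Linkable D B0 I ↔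
        (φ '' I ⊆ TreeGround B0 ∧ Matchable (TreeRel D B0) (φ '' I)) := by
  classical
  obtain ⟨r⟩ := htree.1.nonempty
  have hadj : ∀ a b, D a b → (SimpleGraph.fromRel D).Adj a b := by
    intro a b h
    rw [SimpleGraph.fromRel_adj]
    refine ⟨?_, Or.inl h⟩
    rintro rfl
    exact (hdir _ _ h).2 (hdir _ _ h).1
  set δ := fun x => (SimpleGraph.fromRel D).dist r x with hδ
  have hE : (fun v w => (D v w ∧ δ w = δ v + 1) ∨
      ((v ∈ B0 ∧ w = v) ∨ (D v w ∧ δ v = δ w + 1))) =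
      (fun v w : V => (v ∈ B0 ∧ w = v) ∨ D v w) := by
    funext v w
    apply propext
    constructor
    · rintro (h | h | h)
      · exact Or.inr h.1
      · exact Or.inl h
      · exact Or.inr h.1
    · rintro (h | h)
      · exact Or.inr (Or.inl h)
      · rcases htree.dist_eq_dist_add_one_of_adj r (hadj v w h) with h' | h'
        · exact Or.inr (Or.inr ⟨h, h'⟩)
        · exact Or.inl ⟨h, h'⟩
  have hL : Linkable D B0 = Matchable (fun v w : V => (v ∈ B0 ∧ w = v) ∨ D v w) := by
    funext I
    exact propext (TreeAux.linkable_iff D B0 hD hdir I)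
  haveI : Nonempty V := ⟨r⟩
  refine ⟨?_, fun v => if v ∈ B0 then Sum.inr v else Sum.inl v, ?_, ?_, ?_⟩
  · rw [hL, ← hE]
    refine TreeAux.matroid_of_rooted (fun v w => D v w ∧ δ w = δ v + 1)
      (fun v w => (v ∈ B0 ∧ w = v) ∨ (D v w ∧ δ v = δ w + 1))
      (fun v => if v ∈ B0 then δ v + 1 else δ v) ?_ ?_ ?_
    · rintro v v' w ⟨h1, h2⟩ ⟨h3, h4⟩
      exact TreeAux.parent_unique htree r (hadj _ _ h1) (hadj _ _ h3) h2 h4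
    · rintro v w w' (⟨h1, h2⟩ | ⟨h1, h2⟩) (⟨h3, h4⟩ | ⟨h3, h4⟩)
      · rw [h2, h4]
      · exact absurd h3 (hD v h1 _)
      · exact absurd h1 (hD v h3 _)
      · exact TreeAux.parent_unique htree r (hadj _ _ h1).symm (hadj _ _ h3).symm h2 h4
    · rintro v x w h ⟨h3, h4⟩
      have hx := (hdir _ _ h3).2
      rcases h with ⟨h1, h2⟩ | ⟨h1, h2⟩
      · subst h2
        simp only [hx, h1, if_true, if_false]
        omega
      · have hv := (hdir _ _ h1).2
        simp only [hx, hv, if_false]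
        omega
  · intro a b hab
    by_cases ha : a ∈ B0 <;> by_cases hb : b ∈ B0 <;> simp_all
  · ext x
    constructor
    · rintro ⟨v, rfl⟩
      by_cases hv : v ∈ B0
      · simp [TreeGround, hv]
      · simp [TreeGround, hv]
    · rintro (⟨v, hv, rfl⟩ | ⟨v, hv, rfl⟩)
      · exact ⟨v, by simp only [if_neg hv]⟩
      · exact ⟨v, by simp only [if_pos hv]⟩
  · intro I
    rw [hL]
    set φ : V → V ⊕ V := fun v => if v ∈ B0 then Sum.inr v else Sum.inl v with hφ
    have hrel : ∀ v w, TreeRel D B0 (φ v) w ↔ ((v ∈ B0 ∧ w = v) ∨ D v w) := by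
      intro v w
      by_cases hv : v ∈ B0
      · have h := hD v hv w
        simp [hφ, hv, TreeRel, h]
      · simp only [hφ, hv, if_false, TreeRel, false_and, false_or]
        constructor
        · rintro ⟨h1, h2 | h2⟩
          · exact h2
          · exact absurd h1 (hdir _ _ h2).2
        · intro h
          exact ⟨(hdir _ _ h).1, Or.inl h⟩
    have hψ : ∀ v, Sum.elim id id (φ v) = v := by
      intro v
      by_cases hv : v ∈ B0 <;> simp [hφ, hv]
    constructor
    · rintro ⟨m, hm, hmE⟩
      refine ⟨?_, fun x => m (Sum.elim id id x), ?_, ?_⟩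
      · rintro _ ⟨v, hv, rfl⟩
        by_cases hv : v ∈ B0 <;> simp [hφ, TreeGround, hv]
      · rintro _ ⟨a, ha, rfl⟩ _ ⟨b, hb, rfl⟩ hab
        simp only [hψ] at hab
        rw [hm ha hb hab]
      · rintro _ ⟨v, hv, rfl⟩
        rw [hrel]
        simp only [hψ]
        exact hmE v hv
    · rintro ⟨-, m, hm, hmE⟩
      refine ⟨fun v => m (φ v), ?_, ?_⟩
      · intro a ha b hb hab
        have := hm ⟨a, ha, rfl⟩ ⟨b, hb, rfl⟩ hab
        rw [← hψ a, ← hψ b, this]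
      · intro v hv
        exact (hrel v _).1 (hmE _ ⟨v, hv, rfl⟩)
end

section
/- Let T be the dimaze whose digraph is the countably infinite branching rooted tree with B_0 consisting of the root and the vertices on every other level, all edges directed towards B_0. Then the matroid M_L(T, B_0) has no finite circuit and no finite cocircuit; consequently every dimaze defining a strict gammoid isomorphic to M_L(T, B_0) contains an alternating comb. -/
open Set

universe u

variable {V : Type*}

/-- A circuit of a set system: a minimal dependent set. -/
def IsCircuit {α : Type*} (Ind : Set α → Prop) (C : Set α) : Prop :=
  ¬ Ind C ∧ ∀ C' ⊂ C, Ind C'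

/-- `K` meets every base (maximal independent set) of the set system. -/
def MeetsEveryBase {α : Type*} (Ind : Set α → Prop) (K : Set α) : Prop :=
  ∀ B, MaximalIn Ind B → (K ∩ B).Nonempty

/-- A cocircuit of a set system: a minimal set meeting every base. -/
def IsCocircuit {α : Type*} (Ind : Set α → Prop) (K : Set α) : Prop :=
  MeetsEveryBase Ind K ∧ ∀ K' ⊂ K, ¬ MeetsEveryBase Ind K'

/-- The countably infinite branching rooted tree on `List ℕ` (root `[]`,
children of `l` are `l ++ [n]`), with every edge directed towards the
even levels. -/
def InfTreeAdj : List ℕ → List ℕ → Prop :=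
  fun a b => Even b.length ∧ ((∃ n, a = b ++ [n]) ∨ (∃ n, b = a ++ [n]))

/-- The exits: the root and the vertices on every other level. -/
def InfTreeB0 : Set (List ℕ) := {l | Even l.length}


namespace ACProof

/-- reachability avoiding `X` (except possibly at the start). -/
def Reach (D : V → V → Prop) (X : Set V) (a b : V) : Prop :=
  Relation.ReflTransGen (fun x y => D x y ∧ y ∉ X) a b

def Good (D : V → V → Prop) (B0 : Set V) (X : Set V) (a : V) : Prop :=
  {e | e ∈ B0 ∧ Reach D X a e}.Infinite

theorem Reach.exists_path {D : V → V → Prop} {X : Set V} {a b : V} (h : Reach D X a b)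
    (ha : a ∉ X) : ∃ p : DiPath D, p.first = a ∧ p.last = b ∧ ∀ x ∈ p.verts, x ∉ X := by
  suffices ∃ l : List V, (a :: l).Nodup ∧ (a :: l).IsChain D ∧
      (a :: l).getLast (by simp) = b ∧ ∀ x ∈ a :: l, x ∉ X by
    obtain ⟨l, h1, h2, h3, h4⟩ := this
    exact ⟨⟨a :: l, by simp, h1, h2⟩, rfl, h3, h4⟩
  induction h using Relation.ReflTransGen.head_induction_on with
  | refl => exact ⟨[], by simp, by simp, by simp, by simpa using ha⟩
  | @head a c hac _ ih =>
    obtain ⟨l, h1, h2, h3, h4⟩ := ih hac.2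
    by_cases hmem : a ∈ c :: l
    · obtain ⟨s, t, hst⟩ := List.append_of_mem hmem
      refine ⟨t, ?_, ?_, ?_, ?_⟩
      · rw [hst] at h1; exact (List.nodup_append.1 h1).2.1
      · rw [hst] at h2; exact (List.isChain_append.1 h2).2.1
      · rw [← h3]; simp [hst]
      · intro x hx; apply h4; rw [hst]; simp only [List.mem_append]; exact Or.inr hx
    · refine ⟨c :: l, ?_, ?_, ?_, ?_⟩
      · exact List.nodup_cons.2 ⟨hmem, h1⟩
      · exact List.isChain_cons_cons.2 ⟨hac.1, h2⟩
      · simpa using h3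
      · intro x hx
        rcases List.mem_cons.1 hx with rfl | hx
        · exact ha
        · exact h4 x hx

theorem reach_of_chain {D : V → V → Prop} {X : Set V} : ∀ (l : List V) (a : V),
    (a :: l).IsChain D → (∀ x ∈ a :: l, x ∉ X) → Reach D X a ((a :: l).getLast (by simp))
  | [], a, _, _ => Relation.ReflTransGen.refl
  | c :: l, a, h, h' => by
    rw [List.isChain_cons_cons] at h
    have := reach_of_chain l c h.2 (fun x hx => h' x (List.mem_cons_of_mem _ hx))
    rw [List.getLast_cons (by simp)]
    exact Relation.ReflTransGen.head ⟨h.1, h' c (by simp)⟩ this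

theorem reach_of_path {D : V → V → Prop} {X : Set V} (p : DiPath D)
    (h : ∀ x ∈ p.verts, x ∉ X) : Reach D X p.first p.last := by
  obtain ⟨l, ne, nd, ch⟩ := p
  cases l with
  | nil => exact absurd rfl ne
  | cons a l => exact reach_of_chain l a ch h

theorem reach_split {D : V → V → Prop} {X Y : Set V} {q e : V} (h : Reach D X q e) :
    Reach D (X ∪ Y) q e ∨ ∃ x ∈ Y, Reach D X x e := by
  induction h with
  | refl => exact Or.inl Relation.ReflTransGen.refl
  | @tail c e _ hce ih =>
    rcases ih with ih | ⟨x, hx, hxc⟩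
    · by_cases he : e ∈ Y
      · exact Or.inr ⟨e, he, Relation.ReflTransGen.refl⟩
      · refine Or.inl (ih.tail ⟨hce.1, ?_⟩)
        rintro (h | h)
        · exact hce.2 h
        · exact he h
    · exact Or.inr ⟨x, hx, hxc.tail hce⟩

theorem good_of_not {D : V → V → Prop} {B0 X Y : Set V} {q : V} (hq : Good D B0 X q)
    (hY : Y.Finite) (hn : ∀ y ∈ Y, ¬ Good D B0 X y) : Good D B0 (X ∪ Y) q := by
  intro hfin
  apply hq
  have : (⋃ y ∈ Y, {e | e ∈ B0 ∧ Reach D X y e}).Finite :=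
    hY.biUnion (fun y hy => by simpa [Good] using hn y hy)
  refine (hfin.union this).subset ?_
  rintro e ⟨he, hr⟩
  rcases reach_split (Y := Y) hr with h | ⟨x, hx, h⟩
  · exact Or.inl ⟨he, h⟩
  · exact Or.inr (by simp only [mem_iUnion]; exact ⟨x, hx, he, h⟩)

theorem split_last (p : V → Prop) : ∀ l : List V, (∃ x ∈ l, p x) →
    ∃ A q B, l = A ++ q :: B ∧ p q ∧ ∀ x ∈ B, ¬ p x
  | [], h => by simp at h
  | c :: l, h => by
    by_cases hl : ∃ x ∈ l, p x
    · obtain ⟨A, q, B, h1, h2, h3⟩ := split_last p l hl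
      exact ⟨c :: A, q, B, by simp [h1], h2, h3⟩
    · push Not at hl
      obtain ⟨x, hx, hp⟩ := h
      rcases List.mem_cons.1 hx with rfl | hx
      · exact ⟨[], x, l, rfl, hp, hl⟩
      · exact absurd hp (hl x hx)

theorem split_first (p : V → Prop) : ∀ l : List V, (∃ x ∈ l, p x) →
    ∃ A q B, l = A ++ q :: B ∧ p q ∧ ∀ x ∈ A, ¬ p x
  | [], h => by simp at h
  | c :: l, h => by
    by_cases hc : p c
    · exact ⟨[], c, l, rfl, hc, by simp⟩
    · obtain ⟨x, hx, hp⟩ := h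
      rcases List.mem_cons.1 hx with rfl | hx
      · exact absurd hp hc
      · obtain ⟨A, q, B, h1, h2, h3⟩ := split_first p l ⟨x, hx, hp⟩
        refine ⟨c :: A, q, B, by simp [h1], h2, ?_⟩
        intro y hy
        rcases List.mem_cons.1 hy with rfl | hy
        · exact hc
        · exact h3 y hy

theorem first_mem {D : V → V → Prop} (p : DiPath D) : p.first ∈ p.verts := List.head_mem _
theorem last_mem {D : V → V → Prop} (p : DiPath D) : p.last ∈ p.verts := List.getLast_mem _

theorem eq_of_common {D : V → V → Prop} {B0 : Set V} {P : Set (DiPath D)}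
    (hP : IsLinkage D B0 P) {p q : DiPath D} (hp : p ∈ P) (hq : q ∈ P) {x : V}
    (h1 : x ∈ p.verts) (h2 : x ∈ q.verts) : p = q := by
  by_contra hne
  exact Set.disjoint_left.1 (hP.2 p hp q hq hne) h1 h2

/-- An exit on a path is its last vertex. -/
theorem exit_eq_last {D : V → V → Prop} {B0 : Set V} (hD : IsDimaze D B0) (p : DiPath D)
    {b : V} (hb : b ∈ B0) (h : b ∈ p.verts) : b = p.last := by
  obtain ⟨A, B, hAB⟩ := List.append_of_mem h
  cases B with
  | nil => simp [DiPath.last, hAB]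
  | cons c B =>
    exfalso
    have := p.chain
    rw [hAB] at this
    have h2 := (List.isChain_append.1 this).2.1
    rw [List.isChain_cons_cons] at h2
    exact hD b hb c h2.1

theorem bad_finite {D : V → V → Prop} {B0 : Set V}
    (H1 : ∀ I : Set V, I.Finite → Linkable D B0 I) {X : Set V} (hX : X.Finite) :
    {v | v ∉ X ∧ v ∉ B0 ∧ ¬ Good D B0 X v}.Finite := by
  by_contra hinf
  obtain ⟨U, hU, hcard⟩ := Set.Infinite.exists_subset_card_eq hinf (X.ncard + 1)
  let R : Set V := ⋃ u ∈ U, {e | e ∈ B0 ∧ Reach D X u e}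
  have hR : R.Finite := U.finite_toSet.biUnion (fun u hu => by
    have := (hU hu).2.2
    simpa [Good] using this)
  obtain ⟨P, hP, hI⟩ := H1 (↑U ∪ R) (U.finite_toSet.union hR)
  have key : ∀ u ∈ U, ∃ p ∈ P, p.first = u ∧ ∃ x ∈ p.verts, x ∈ X := by
    intro u hu
    have : u ∈ Ini P := by rw [hI]; exact Or.inl hu
    obtain ⟨p, hp, hpu⟩ := this
    refine ⟨p, hp, hpu, ?_⟩
    by_contra hno
    push Not at hno
    have hr := reach_of_path p hno
    rw [hpu] at hr
    have hlR : p.last ∈ Ini P := by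
      rw [hI]; right
      simp only [R, mem_iUnion]
      exact ⟨u, hu, hP.1 p hp, hr⟩
    obtain ⟨q, hq, hql⟩ := hlR
    have : q = p := eq_of_common hP hq hp (x := p.last) (hql ▸ first_mem q) (last_mem p)
    subst this
    apply (hU hu).2.1
    rw [← hpu, hql]; exact hP.1 q hp
  choose! p hpP hpf x hxp hxX using key
  have : U.card ≤ hX.toFinset.card := by
    apply Finset.card_le_card_of_injOn x
    · intro u hu; simpa using hxX u hu
    · intro u hu v hv huv
      have := eq_of_common hP (hpP u hu) (hpP v hv) (hxp u hu) (huv ▸ hxp v hv)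
      rw [← hpf u hu, this, hpf v hv]
  rw [hcard, Set.ncard_eq_toFinset_card X hX] at this
  omega

theorem base_onto {D : V → V → Prop} {B0 : Set V} (hD : IsDimaze D B0) {B : Set V}
    (hB : MaximalIn (Linkable D B0) B) {P : Set (DiPath D)} (hP : IsLinkage D B0 P)
    (hI : Ini P = B) {e : V} (he : e ∈ B0) : ∃ p ∈ P, p.last = e := by
  by_contra hno
  push Not at hno
  have hnot : ∀ p ∈ P, e ∉ p.verts := fun p hp h => hno p hp (exit_eq_last hD p he h).symm
  let t : DiPath D := ⟨[e], by simp, by simp, List.isChain_singleton e⟩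
  have hl : Linkable D B0 (insert e B) := by
    refine ⟨insert t P, ⟨?_, ?_⟩, ?_⟩
    · rintro p (rfl | hp)
      · exact he
      · exact hP.1 p hp
    · rintro p (rfl | hp) q (rfl | hq) hne
      · exact absurd rfl hne
      · rw [Set.disjoint_left]
        intro x hx hx'
        have : x = e := by simpa [DiPath.vertSet, t] using hx
        exact hnot q hq (this ▸ hx')
      · rw [Set.disjoint_left]
        intro x hx' hx
        have : x = e := by simpa [DiPath.vertSet, t] using hx
        exact hnot p hp (this ▸ hx')
      · exact hP.2 p hp q hq hne
    · rw [← hI]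
      ext v
      constructor
      · rintro ⟨p, (rfl | hp), rfl⟩
        · exact Or.inl rfl
        · exact Or.inr ⟨p, hp, rfl⟩
      · rintro (rfl | ⟨p, hp, rfl⟩)
        · exact ⟨t, Or.inl rfl, rfl⟩
        · exact ⟨p, Or.inr hp, rfl⟩
  have : insert e B = B := hB.2 _ hl (Set.subset_insert _ _)
  have heB : e ∈ B := this ▸ Set.mem_insert e B
  rw [← hI] at heB
  obtain ⟨p, hp, hpe⟩ := heB
  exact hnot p hp (hpe ▸ first_mem p)

theorem enter {D : V → V → Prop} {B0 : Set V} (hD : IsDimaze D B0)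
    (H1 : ∀ I : Set V, I.Finite → Linkable D B0 I)
    (H2 : ∀ X : Set V, X.Finite → ∃ B, MaximalIn (Linkable D B0) B ∧ Disjoint X B)
    {X G : Set V} {E : Finset V} (hX : X.Finite) (hG : G.Finite) (hEX : ↑E ⊆ X)
    (hEB : ↑E ⊆ B0) (hcard : G.ncard < E.card) :
    ∃ (q : V) (Q : List V) (w : V), (q :: Q ++ [w]).IsChain D ∧ (q :: Q).Nodup ∧
      (∀ x ∈ q :: Q, x ∉ X) ∧ w ∈ X ∧ w ∉ G ∧ Good D B0 (X ∪ {x | x ∈ Q}) q := by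
  obtain ⟨B, hB, hdis⟩ := H2 (X ∪ {v | v ∉ X ∧ v ∉ B0 ∧ ¬ Good D B0 X v})
    (hX.union (bad_finite H1 hX))
  obtain ⟨P, hP, hI⟩ := hB.1
  have hon : ∀ e ∈ E, ∃ p ∈ P, p.last = e := fun e he => base_onto hD hB hP hI (hEB he)
  have : ∃ p ∈ P, p.last ∈ E ∧ ∀ x ∈ p.verts, x ∉ G := by
    by_contra hno
    push Not at hno
    obtain ⟨e0, he0⟩ : E.Nonempty := Finset.card_pos.1 (by omega)
    have : Nonempty (DiPath D) := ⟨(hon e0 he0).choose⟩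
    choose! p hpP hpl using hon
    have key : ∀ e ∈ E, ∃ x ∈ (p e).verts, x ∈ G := fun e he =>
      hno (p e) (hpP e he) (by rw [hpl e he]; exact he)
    choose! x hxp hxG using key
    have : E.card ≤ hG.toFinset.card := by
      apply Finset.card_le_card_of_injOn x
      · intro u hu; simpa using hxG u hu
      · intro u hu v hv huv
        have := eq_of_common hP (hpP u hu) (hpP v hv) (hxp u hu) (huv ▸ hxp v hv)
        rw [← hpl u hu, this, hpl v hv]
    rw [Set.ncard_eq_toFinset_card G hG] at hcard
    omega
  obtain ⟨p, hpP, hpE, hpG⟩ := this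
  have hfB : p.first ∈ B := by rw [← hI]; exact ⟨p, hpP, rfl⟩
  have hf := fun h => Set.disjoint_left.1 hdis h hfB
  obtain ⟨A, w, R, hv, hw, hA⟩ := split_first (· ∈ X) p.verts ⟨p.last, last_mem p, hEX hpE⟩
  have hfX : p.first ∉ X := fun h => hf (Or.inl h)
  cases A with
  | nil =>
    exfalso
    apply hfX
    have : p.first = w := by simp [DiPath.first, hv]
    rw [this]; exact hw
  | cons y A =>
    have hy : p.first = y := by simp [DiPath.first, hv]
    have hyB : y ∉ B0 := by
      intro h
      have := exit_eq_last hD p h (by simp [hv])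
      exact hA y (by simp) (this ▸ hEX hpE)
    have hgood : Good D B0 X y := by
      by_contra hg
      exact hf (Or.inr (by rw [hy]; exact ⟨hA y (by simp), hyB, hg⟩))
    obtain ⟨A', q, Q, hAQ, hq, hQ⟩ := split_last (Good D B0 X) (y :: A) ⟨y, by simp, hgood⟩
    have hch := p.chain
    have hnd := p.nodup
    rw [hv, hAQ] at hch hnd
    have e1 : A' ++ q :: Q ++ w :: R = A' ++ ((q :: Q ++ [w]) ++ R) := by simp
    rw [e1] at hch hnd
    refine ⟨q, Q, w, ?_, ?_, ?_, hw, ?_, ?_⟩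
    · exact (List.isChain_append.1 (List.isChain_append.1 hch).2.1).1
    · exact (List.nodup_append.1 (List.nodup_append.1 (List.nodup_append.1 hnd).2.1).1).1
    · intro x hx
      apply hA
      rw [hAQ]
      exact List.mem_append_right _ hx
    · exact hpG w (by simp [hv])
    · exact good_of_not hq (List.finite_toSet Q) hQ


/-- compatibility of consecutive entries of the ray -/
def Step (D : V → V → Prop) (T : Set (DiPath D)) (x y : V × Bool) : Prop :=
  (if x.2 then D x.1 y.1 else D y.1 x.1) ∧
    (x.2 = true → y.2 = false → ∃ t ∈ T, t.first = y.1)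

structure St (D : V → V → Prop) where
  L : List (V × Bool)
  a : V
  F : Set V
  T : Set (DiPath D)

structure Inv (D : V → V → Prop) (B0 : Set V) (s : St D) : Prop where
  ne : s.L ≠ []
  chain : (s.L ++ [(s.a, true)]).IsChain (Step D s.T)
  nodup : (s.L.map Prod.fst).Nodup
  sub : ∀ x ∈ s.L, x.1 ∈ s.F
  anot : s.a ∉ s.F
  fin : s.F.Finite
  good : Good D B0 s.F s.a
  tsub : ∀ t ∈ s.T, ∀ x ∈ t.verts, x ∈ s.F
  link : IsLinkage D B0 s.T
  meet : ∀ t ∈ s.T, ∀ v ∈ t.verts, v ∈ s.L.map Prod.fst → v = t.first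
  tfirst : ∀ x ∈ s.L.head?, ∃ t ∈ s.T, t.first = x.1
  tini : ∀ t ∈ s.T, (∃ x ∈ s.L.head?, t.first = x.1) ∨
    ∃ k x, s.L[k]? = some (x, true) ∧ s.L[k+1]? = some (t.first, false)

theorem Step.mono {D : V → V → Prop} {T T' : Set (DiPath D)} (h : T ⊆ T') {x y : V × Bool}
    (hs : Step D T x y) : Step D T' x y :=
  ⟨hs.1, fun h1 h2 => let ⟨t, ht, e⟩ := hs.2 h1 h2; ⟨t, h ht, e⟩⟩

theorem back_chain {D : V → V → Prop} {T : Set (DiPath D)} {q w : V} {Q : List V}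
    (h : (q :: Q ++ [w]).IsChain D) :
    ((w :: Q.reverse).map (fun v => (v, false)) ++ [(q, true)]).IsChain (Step D T) := by
  have h1 : (w :: Q.reverse ++ [q]).IsChain (fun a b => D b a) := by
    rw [← List.isChain_reverse]
    simpa using h
  rw [List.isChain_append] at h1 ⊢
  refine ⟨?_, by simp, ?_⟩
  · rw [List.isChain_map]
    exact h1.1.imp (fun a b hab => ⟨by simpa using hab, by simp⟩)
  · intro x hx y hy
    have h3 := h1.2.2
    rw [List.getLast?_map] at hx
    simp only [Option.mem_def, Option.map_eq_some_iff] at hx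
    obtain ⟨z, hz, rfl⟩ := hx
    simp at hy
    subst hy
    exact ⟨by simpa using h3 z hz q (by simp), by simp⟩

theorem start {D : V → V → Prop} {B0 : Set V} (hD : IsDimaze D B0)
    (H1 : ∀ I : Set V, I.Finite → Linkable D B0 I)
    (H2 : ∀ X : Set V, X.Finite → ∃ B, MaximalIn (Linkable D B0) B ∧ Disjoint X B)
    {b : V} (hb : b ∈ B0) : ∃ s, Inv D B0 s := by
  obtain ⟨q, Q, w, hch, hnd, hX, hw, -, hg⟩ := enter hD H1 H2 (X := {b}) (G := ∅) (E := {b})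
    (by simp) (by simp) (by simp) (by simpa using hb) (by simp)
  obtain rfl : w = b := hw
  let t : DiPath D := ⟨[w], by simp, by simp, List.isChain_singleton w⟩
  refine ⟨⟨(w :: Q.reverse).map (fun v => (v, false)), q, {w} ∪ {x | x ∈ Q}, {t}⟩, ?_⟩
  have hwQ : w ∉ Q := fun h => hX w (by simp [h]) rfl
  constructor
  · simp
  · exact back_chain hch
  · have : ∀ l : List V, (l.map (fun v => (v, false))).map Prod.fst = l := by
      intro l; simp [Function.comp_def]
    simp only [this]
    rw [List.nodup_cons]
    simp only [List.mem_reverse, List.nodup_reverse]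
    exact ⟨hwQ, (List.nodup_cons.1 hnd).2⟩
  · intro x hx
    simp at hx
    rcases hx with rfl | ⟨y, hy, rfl⟩
    · simp
    · simp [hy]
  · simp only [mem_union, mem_singleton_iff, mem_ofPred_eq, not_or]
    exact ⟨fun h => hX q (by simp) h, (List.nodup_cons.1 hnd).1⟩
  · exact (Set.finite_singleton w).union (List.finite_toSet Q)
  · exact hg
  · rintro t' rfl x hx
    have : x = w := by simpa [t] using hx
    simp [this]
  · refine ⟨?_, ?_⟩
    · rintro p rfl; exact hb
    · rintro p rfl q rfl hne; exact absurd rfl hne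
  · rintro t' rfl x hx -
    have : x = w := by simpa [t] using hx
    exact this
  · intro x hx
    simp at hx
    exact ⟨t, rfl, by rw [← hx]; rfl⟩
  · rintro t' rfl
    exact Or.inl ⟨(w, false), by simp, rfl⟩

theorem next {D : V → V → Prop} {B0 : Set V} (hD : IsDimaze D B0)
    (H1 : ∀ I : Set V, I.Finite → Linkable D B0 I)
    (H2 : ∀ X : Set V, X.Finite → ∃ B, MaximalIn (Linkable D B0) B ∧ Disjoint X B)
    (s : St D) (hs : Inv D B0 s) : ∃ s', Inv D B0 s' ∧ s.L <+: s'.L ∧ s.T ⊆ s'.T ∧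
      ∃ k ≥ s.L.length, ∃ x y, s'.L[k]? = some (x, true) ∧ s'.L[k+1]? = some (y, false) := by
  obtain ⟨L, a, F, T⟩ := s
  obtain ⟨ne, chain, nodup, sub, anot, fin, good, tsub, link, meet, tfirst, tini⟩ := hs
  dsimp only at *
  obtain ⟨E, hE, hcard⟩ := Set.Infinite.exists_subset_card_eq good (F.ncard + 2)
  have hp : ∀ e ∈ E, ∃ p : DiPath D, p.first = a ∧ p.last = e ∧ ∀ x ∈ p.verts, x ∉ F :=
    fun e he => (hE he).2.exists_path anot
  have : Nonempty (DiPath D) := ⟨⟨[a], by simp, by simp, List.isChain_singleton a⟩⟩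
  choose! p hpf hpl hpF using hp
  let S : Set V := ⋃ e ∈ E, {x | x ∈ (p e).verts}
  have hS : S.Finite := E.finite_toSet.biUnion (fun e _ => List.finite_toSet _)
  have hSF : ∀ x ∈ S, x ∉ F := by
    intro x hx
    simp only [S, mem_iUnion] at hx
    obtain ⟨e, he, hx⟩ := hx
    exact hpF e he x hx
  obtain ⟨q, Q, w, hch, hnd, hX, hw, hwG, hg⟩ := enter hD H1 H2 (X := F ∪ S)
    (G := insert a F) (E := E) (fin.union hS) (fin.insert a)
    (fun e he => Or.inr (by
      simp only [S, mem_iUnion]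
      refine ⟨e, he, ?_⟩
      have := last_mem (p e)
      rwa [hpl e he] at this))
    (fun e he => (hE he).1) (by
      have := Set.ncard_insert_le a F
      omega)
  have hwa : w ≠ a := fun h => hwG (Or.inl h)
  have hwF : w ∉ F := fun h => hwG (Or.inr h)
  have hwS : w ∈ S := hw.resolve_left hwF
  simp only [S, mem_iUnion] at hwS
  obtain ⟨e, he, hwe⟩ := hwS
  obtain ⟨A, R, hAR⟩ := List.append_of_mem (show w ∈ (p e).verts from hwe)
  have hpS : ∀ x ∈ A ++ w :: R, x ∈ S := by
    intro x hx
    simp only [S, mem_iUnion]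
    exact ⟨e, he, by rw [mem_ofPred_eq, hAR]; exact hx⟩
  have hpch : (A ++ w :: R).IsChain D := hAR ▸ (p e).chain
  have hpnd : (A ++ w :: R).Nodup := hAR ▸ (p e).nodup
  obtain ⟨A', rfl⟩ : ∃ A', A = a :: A' := by
    have h1 := hpf e he
    cases A with
    | nil => exact absurd (by simpa [DiPath.first, hAR] using h1) hwa
    | cons y A => exact ⟨A, by have : y = a := by simpa [DiPath.first, hAR] using h1
                               rw [this]⟩
  set A := a :: A' with hAdef
  let t : DiPath D := ⟨w :: R, by simp, (List.nodup_append.1 hpnd).2.1,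
    (List.isChain_append.1 hpch).2.1⟩
  have htl : t.last ∈ B0 := by
    have : t.last = e := by
      rw [← hpl e he]; simp [DiPath.last, t, hAR]
    rw [this]; exact (hE he).1
  have htF : ∀ x ∈ t.verts, x ∈ S := fun x hx => hpS x (List.mem_append_right _ hx)
  have hTT : T ⊆ insert t T := Set.subset_insert _ _
  have hfst : ∀ (l : List V) (b : Bool), (l.map (fun v => (v, b))).map Prod.fst = l := by
    intro l b; simp [Function.comp_def]
  let N : List (V × Bool) := A.map (fun v => (v, true)) ++
    (w :: Q.reverse).map (fun v => (v, false))
  have hN1 : N[A'.length]? = some ((a :: A')[A'.length]'(by simp), true) := by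
    simp only [N]
    rw [List.getElem?_append_left (by simp [hAdef]), List.getElem?_map,
      List.getElem?_eq_getElem (by simp [hAdef])]
    rfl
  have hNfst : N.map Prod.fst = A ++ w :: Q.reverse := by
    simp only [N, List.map_append, hfst]
  have hLF : ∀ x ∈ L.map Prod.fst, x ∈ F := by
    intro x hx
    obtain ⟨y, hy, rfl⟩ := List.mem_map.1 hx
    exact sub y hy
  have hNmem : ∀ x ∈ N.map Prod.fst, x ∈ S ∨ x ∈ Q := by
    intro x hx
    rw [hNfst] at hx
    simp only [List.mem_append, List.mem_cons, List.mem_reverse] at hx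
    rcases hx with h | rfl | h
    · exact Or.inl (hpS x (List.mem_append_left _ h))
    · exact Or.inl (hpS x (by simp))
    · exact Or.inr h
  have hQX : ∀ x ∈ Q, x ∉ F ∧ x ∉ S := fun x hx =>
    ⟨fun h => hX x (by simp [hx]) (Or.inl h), fun h => hX x (by simp [hx]) (Or.inr h)⟩
  have hNF : ∀ x ∈ N.map Prod.fst, x ∉ F := by
    intro x hx
    rcases hNmem x hx with h | h
    · exact hSF x h
    · exact (hQX x h).1
  refine ⟨⟨L ++ N, q, F ∪ S ∪ {x | x ∈ Q}, insert t T⟩, ?_, ?_, hTT, ?_⟩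
  · constructor <;> dsimp only
    · simp [ne]
    · -- chain
      rw [List.append_assoc, List.isChain_append] 
      have c1 := List.isChain_append.1 chain
      refine ⟨c1.1.imp (fun _ _ h => h.mono hTT), ?_, ?_⟩
      · simp only [N]
        rw [List.append_assoc, List.isChain_append]
        have c2 := List.isChain_append.1 hpch
        refine ⟨?_, back_chain hch, ?_⟩
        · rw [List.isChain_map]
          exact c2.1.imp (fun a b hab => ⟨by simpa using hab, by simp⟩)
        · intro x hx y hy
          rw [List.getLast?_map] at hx
          simp only [Option.mem_def, Option.map_eq_some_iff] at hx
          obtain ⟨z, hz, rfl⟩ := hx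
          simp at hy
          subst hy
          exact ⟨by simpa using c2.2.2 z hz w (by simp), fun _ _ => ⟨t, Or.inl rfl, rfl⟩⟩
      · intro x hx y hy
        have : y = (a, true) := by simpa [N, hAdef, eq_comm] using hy
        subst this
        exact (c1.2.2 x hx (a, true) (by simp)).mono hTT
    · rw [List.map_append, List.nodup_append]
      refine ⟨nodup, ?_, ?_⟩
      · rw [hNfst, List.nodup_append]
        refine ⟨(List.nodup_append.1 hpnd).1, ?_, ?_⟩
        · rw [List.nodup_cons]
          simp only [List.mem_reverse, List.nodup_reverse]
          exact ⟨fun h => (hQX w h).2 (hpS w (by simp)), (List.nodup_cons.1 hnd).2⟩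
        · intro x hx y hy hxy
          subst hxy
          rcases List.mem_cons.1 hy with rfl | hy
          · exact (List.nodup_append.1 hpnd).2.2 x hx x (by simp) rfl
          · exact (hQX x (by simpa using hy)).2 (hpS x (List.mem_append_left _ hx))
      · intro x hx y hy hxy
        subst hxy
        exact hNF x hy (hLF x hx)
    · intro x hx
      rcases List.mem_append.1 hx with hx | hx
      · exact Or.inl (Or.inl (sub x hx))
      · rcases hNmem x.1 (List.mem_map_of_mem hx) with h | h
        · exact Or.inl (Or.inr h)
        · exact Or.inr h
    · rintro (h | h)
      · exact hX q (by simp) h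
      · exact (List.nodup_cons.1 hnd).1 h
    · exact (fin.union hS).union (List.finite_toSet Q)
    · exact hg
    · rintro t' (rfl | ht') x hx
      · exact Or.inl (Or.inr (htF x hx))
      · exact Or.inl (Or.inl (tsub t' ht' x hx))
    · refine ⟨?_, ?_⟩
      · rintro p' (rfl | hp')
        · exact htl
        · exact link.1 p' hp'
      · rintro p' (rfl | hp') q' (rfl | hq') hne
        · exact absurd rfl hne
        · rw [Set.disjoint_left]
          exact fun x hx hx' => hSF x (htF x hx) (tsub q' hq' x hx')
        · rw [Set.disjoint_left]
          exact fun x hx' hx => hSF x (htF x hx) (tsub p' hp' x hx')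
        · exact link.2 p' hp' q' hq' hne
    · intro t' ht' v hv hvL
      rw [List.map_append, List.mem_append] at hvL
      rcases ht' with rfl | ht'
      · rcases hvL with h | h
        · exact absurd (hLF v h) (hSF v (htF v hv))
        · rw [hNfst, List.mem_append (s := A), List.mem_cons (l := Q.reverse), List.mem_reverse] at h
          rcases h with h | h | h
          · exact absurd rfl ((List.nodup_append.1 hpnd).2.2 v h v hv)
          · exact h
          · exact absurd (htF v hv) (hQX v h).2
      · rcases hvL with h | h
        · exact meet t' ht' v hv h
        · exact absurd (tsub t' ht' v hv) (hNF v h)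
    · intro x hx
      rw [List.head?_append_of_ne_nil _ ne] at hx
      obtain ⟨t', ht', h⟩ := tfirst x hx
      exact ⟨t', hTT ht', h⟩
    · rintro t' (rfl | ht')
      · right
        refine ⟨L.length + A'.length, (a :: A')[A'.length]'(by simp), ?_, ?_⟩
        · rw [List.getElem?_append_right (by omega)]
          simpa using hN1
        · rw [List.getElem?_append_right (by omega)]
          have : L.length + A'.length + 1 - L.length = A'.length + 1 := by omega
          rw [this]
          simp [N, hAdef, t, DiPath.first]
      · rcases tini t' ht' with ⟨x, hx, h⟩ | ⟨k, x, h1, h2⟩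
        · left
          exact ⟨x, by rw [List.head?_append_of_ne_nil _ ne]; exact hx, h⟩
        · right
          refine ⟨k, x, ?_, ?_⟩
          · rw [List.getElem?_append_left (List.getElem?_eq_some_iff.1 h1).1]; exact h1
          · rw [List.getElem?_append_left (List.getElem?_eq_some_iff.1 h2).1]; exact h2
  · exact List.prefix_append _ _
  · refine ⟨L.length + A'.length, by simp, (a :: A')[A'.length]'(by simp), w, ?_, ?_⟩
    · dsimp only
      rw [List.getElem?_append_right (by omega)]
      simpa using hN1
    · dsimp only
      rw [List.getElem?_append_right (by omega)]
      have : L.length + A'.length + 1 - L.length = A'.length + 1 := by omega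
      rw [this]
      simp [N, hAdef]

theorem comb {D : V → V → Prop} {B0 : Set V} (hD : IsDimaze D B0)
    (H1 : ∀ I : Set V, I.Finite → Linkable D B0 I)
    (H2 : ∀ X : Set V, X.Finite → ∃ B, MaximalIn (Linkable D B0) B ∧ Disjoint X B)
    {b : V} (hb : b ∈ B0) : ContainsAltComb D B0 := by
  obtain ⟨s0, hs0⟩ := start hD H1 H2 hb
  choose g hgI hgL hgT hgk using next hD H1 H2
  obtain ⟨S, hL1, hT1, hk1⟩ : ∃ S : ℕ → {s : St D // Inv D B0 s},
      (∀ n, (S n).1.L <+: (S (n+1)).1.L) ∧ (∀ n, (S n).1.T ⊆ (S (n+1)).1.T) ∧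
      (∀ n, ∃ k ≥ (S n).1.L.length, ∃ x y, (S (n+1)).1.L[k]? = some (x, true) ∧
        (S (n+1)).1.L[k+1]? = some (y, false)) :=
    ⟨fun n => Nat.rec ⟨s0, hs0⟩ (fun _ s => ⟨g s.1 s.2, hgI s.1 s.2⟩) n,
      fun n => hgL _ _, fun n => hgT _ _, fun n => hgk _ _⟩
  have hTm : Monotone (fun n => (S n).1.T) := monotone_nat_of_le_succ hT1
  have hLm : ∀ m n, m ≤ n → (S m).1.L <+: (S n).1.L := by
    intro m n h
    induction h with
    | refl => exact List.prefix_refl _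
    | step _ ih => exact ih.trans (hL1 _)
  have hlen : ∀ n, n < (S n).1.L.length := by
    intro n
    induction n with
    | zero => exact List.length_pos_iff.2 (S 0).2.ne
    | succ n ih =>
      obtain ⟨k, hk, x, y, h1, h2⟩ := hk1 n
      have := (List.getElem?_eq_some_iff.1 h2).1
      omega
  let f : ℕ → V × Bool := fun n => (S n).1.L[n]'(hlen n)
  have hf : ∀ m n (h : n < (S m).1.L.length), (S m).1.L[n] = f n := by
    intro m n h
    rcases le_total m n with hmn | hmn
    · exact (hLm m n hmn).getElem h
    · exact ((hLm n m hmn).getElem (hlen n)).symm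
  have hf' : ∀ m n x, (S m).1.L[n]? = some x → f n = x := by
    intro m n x h
    obtain ⟨h1, h2⟩ := List.getElem?_eq_some_iff.1 h
    rw [← hf m n h1, h2]
  have hstep : ∀ n, Step D (S (n+1)).1.T (f n) (f (n+1)) := by
    intro n
    have hc := (List.isChain_append.1 (S (n+1)).2.chain).1
    have h2 := hlen (n+1)
    have := List.isChain_iff_getElem.1 hc n (by omega)
    rwa [hf, hf] at this
  have hhead : ∀ m, ∀ x ∈ (S m).1.L.head?, x = f 0 := by
    intro m x hx
    rw [List.head?_eq_getElem?] at hx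
    exact (hf' m 0 x hx).symm
  have hmem : ∀ m n, n ≤ m → (f n).1 ∈ (S m).1.L.map Prod.fst := by
    intro m n h
    have h1 := hlen m
    rw [← hf m n (by omega)]
    exact List.mem_map_of_mem (List.getElem_mem _)
  refine ⟨fun n => (f n).1, fun n => (f n).2, ⋃ n, (S n).1.T, ?_, ?_, ?_, ?_, ?_, ?_⟩
  · intro m n hmn
    dsimp only at hmn
    have h1 := hlen (max m n)
    have hm : m < (S (max m n)).1.L.length := by omega
    have hn : n < (S (max m n)).1.L.length := by omega
    rw [← hf (max m n) m hm, ← hf (max m n) n hn] at hmn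
    have := (S (max m n)).2.nodup
    exact (List.Nodup.getElem_inj_iff this (i := m) (j := n) (hi := by simpa using hm)
      (hj := by simpa using hn)).1 (by simpa using hmn)
  · intro n
    exact (hstep n).1
  · intro N
    obtain ⟨k, hk, x, y, h1, h2⟩ := hk1 N
    refine ⟨k, by have := hlen N; omega, ?_, ?_⟩
    · dsimp only; rw [hf' _ _ _ h1]
    · dsimp only; rw [hf' _ _ _ h2]
  · refine ⟨?_, ?_⟩
    · intro p hp
      obtain ⟨n, hn⟩ := mem_iUnion.1 hp
      exact (S n).2.link.1 p hn
    · intro p hp q hq hne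
      obtain ⟨n, hn⟩ := mem_iUnion.1 hp
      obtain ⟨m, hm⟩ := mem_iUnion.1 hq
      exact (S (max n m)).2.link.2 p (hTm (le_max_left n m) hn) q (hTm (le_max_right n m) hm) hne
  · ext v
    constructor
    · rintro ⟨t, ht, rfl⟩
      obtain ⟨n, hn⟩ := mem_iUnion.1 ht
      rcases (S n).2.tini t hn with ⟨x, hx, h⟩ | ⟨k, x, h1, h2⟩
      · left; rw [h, hhead n x hx]
      · right
        refine ⟨k, ?_, ?_, ?_⟩
        · dsimp only; rw [hf' _ _ _ h1]
        · dsimp only; rw [hf' _ _ _ h2]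
        · dsimp only; rw [hf' _ _ _ h2]
    · rintro (rfl | ⟨k, h1, h2, rfl⟩)
      · obtain ⟨t, ht, h⟩ := (S 0).2.tfirst (f 0) (by
          rw [List.head?_eq_getElem?]; exact List.getElem?_eq_getElem (hlen 0))
        exact ⟨t, mem_iUnion.2 ⟨0, ht⟩, h⟩
      · obtain ⟨t, ht, h⟩ := (hstep k).2 h1 h2
        exact ⟨t, mem_iUnion.2 ⟨k+1, ht⟩, h⟩
  · rintro t ht v hv ⟨n, rfl⟩
    obtain ⟨m, hm⟩ := mem_iUnion.1 ht
    exact (S (max m n)).2.meet t (hTm (le_max_left m n) hm) _ hv (hmem _ n (le_max_right m n))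


theorem tree_dimaze_out {b v : List ℕ} (hb : b ∈ InfTreeB0) : ¬ InfTreeAdj b v := by
  rintro ⟨hv, ⟨n, rfl⟩ | ⟨n, rfl⟩⟩
  · simp only [InfTreeB0, Set.mem_ofPred_eq, List.length_append, List.length_singleton] at hb
    exact (Nat.even_add_one.1 hb) hv
  · simp only [List.length_append, List.length_singleton] at hv
    exact (Nat.even_add_one.1 hv) hb

theorem exists_N (I : Set (List ℕ)) (hI : I.Finite) : ∃ N : ℕ, ∀ v, v ++ [N] ∉ I := by
  obtain ⟨N, hN⟩ := ((hI.image (fun l => l.getLastD 0)).infinite_compl).nonempty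
  refine ⟨N, fun v hv => hN ⟨v ++ [N], hv, by simp⟩⟩

/-- one-vertex path -/
def sing {D : V → V → Prop} (v : V) : DiPath D := ⟨[v], by simp, by simp, List.isChain_singleton v⟩

/-- one-edge path -/
def edge {D : V → V → Prop} (v w : V) (h : D v w) (hne : v ≠ w) : DiPath D :=
  ⟨[v, w], by simp, by simpa using hne, List.isChain_pair.2 h⟩

theorem tree_ne {v w : List ℕ} (h : InfTreeAdj v w) : v ≠ w := by
  rintro rfl
  exact tree_dimaze_out h.1 h

/-- Linkable from an injective partial matching along edges or identities. -/
theorem linkable_of (I : Set (List ℕ)) (m : List ℕ → List ℕ)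
    (h1 : ∀ v ∈ I, v = m v ∨ InfTreeAdj v (m v)) (h2 : ∀ v ∈ I, m v ∈ InfTreeB0)
    (h3 : Set.InjOn m I) : Linkable InfTreeAdj InfTreeB0 I := by
  have key : ∀ v ∈ I, ∃ p : DiPath InfTreeAdj, p.first = v ∧ p.last = m v ∧
      ∀ x ∈ p.verts, x = m v ∨ (x = v ∧ x ∉ InfTreeB0) := by
    intro v hv
    rcases h1 v hv with h | h
    · exact ⟨sing v, rfl, h, fun x hx => Or.inl (by
        have : x = v := by simpa [sing] using hx
        rw [this]; exact h)⟩
    · refine ⟨edge v (m v) h (tree_ne h), rfl, rfl, ?_⟩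
      intro x hx
      have : x = v ∨ x = m v := by simpa [edge] using hx
      rcases this with rfl | h'
      · exact Or.inr ⟨rfl, fun hb => tree_dimaze_out hb h⟩
      · exact Or.inl h'
  have : Nonempty (DiPath InfTreeAdj) := ⟨sing []⟩
  choose! p hpf hpl hpx using key
  refine ⟨p '' I, ⟨?_, ?_⟩, ?_⟩
  · rintro _ ⟨v, hv, rfl⟩
    rw [hpl v hv]; exact h2 v hv
  · rintro _ ⟨v, hv, rfl⟩ _ ⟨w, hw, rfl⟩ hne
    rw [Set.disjoint_left]
    intro x hx hx'
    apply hne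
    rcases hpx v hv x hx with h | ⟨h, h'⟩ <;> rcases hpx w hw x hx' with g | ⟨g, g'⟩
    · rw [h3 hv hw (h.symm.trans g)]
    · exact absurd (h ▸ h2 v hv) g'
    · exact absurd (g ▸ h2 w hw) h'
    · rw [← h, ← g]
  · ext v
    constructor
    · rintro ⟨_, ⟨w, hw, rfl⟩, rfl⟩
      rw [hpf w hw]; exact hw
    · intro hv
      exact ⟨p v, ⟨v, hv, rfl⟩, hpf v hv⟩

theorem not_even_child {v : List ℕ} {N : ℕ} (h : Even v.length) : ¬ Even (v ++ [N]).length := by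
  simp only [List.length_append, List.length_singleton]
  exact fun h' => (Nat.even_add_one.1 h') h

theorem tree_H1 (I : Set (List ℕ)) (hI : I.Finite) : Linkable InfTreeAdj InfTreeB0 I := by
  classical
  obtain ⟨N, hN⟩ := exists_N I hI
  have hev : ∀ v : List ℕ, ¬ Even v.length → Even (v ++ [N]).length := by
    intro v hv
    simp only [List.length_append, List.length_singleton]
    exact Nat.even_add_one.2 hv
  apply linkable_of I (fun v => if Even v.length then v else v ++ [N])
  · intro v hv
    by_cases h : Even v.length
    · simp [h]
    · right
      simp only [h, if_false]
      exact ⟨hev v h, Or.inr ⟨N, rfl⟩⟩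
  · intro v hv
    by_cases h : Even v.length
    · simpa [h, InfTreeB0] using h
    · simp only [h, if_false]
      exact hev v h
  · intro v hv w hw h
    dsimp only at h
    split_ifs at h with h1 h2 h2
    · exact h
    · exact absurd (h ▸ hv) (hN w)
    · exact absurd (h ▸ hw) (hN v)
    · exact List.append_cancel_right h

theorem tree_H2 (K : Set (List ℕ)) (hK : K.Finite) :
    ∃ B, MaximalIn (Linkable InfTreeAdj InfTreeB0) B ∧ Disjoint K B := by
  classical
  obtain ⟨N, hN⟩ := exists_N K hK
  let Y : Set (List ℕ) := (fun b => b ++ [N]) '' (K ∩ InfTreeB0)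
  have hYodd : ∀ y ∈ Y, y ∉ InfTreeB0 := by
    rintro _ ⟨b, hb, rfl⟩
    exact not_even_child hb.2
  refine ⟨(InfTreeB0 \ K) ∪ Y, ⟨?_, ?_⟩, ?_⟩
  · apply linkable_of _ (fun v => if Even v.length then v else v.dropLast)
    · rintro v (⟨hv, -⟩ | ⟨b, hb, rfl⟩)
      · left; exact (if_pos hv).symm
      · right
        simp only [not_even_child (N := N) hb.2, if_false, List.dropLast_concat]
        exact ⟨hb.2, Or.inl ⟨N, rfl⟩⟩
    · rintro v (⟨hv, -⟩ | ⟨b, hb, rfl⟩)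
      · rw [if_pos (show Even v.length from hv)]; exact hv
      · simp only [not_even_child (N := N) hb.2, if_false, List.dropLast_concat]
        exact hb.2
    · rintro v (⟨hv, hvK⟩ | ⟨b, hb, rfl⟩) w (⟨hw, hwK⟩ | ⟨c, hc, rfl⟩) h
      · simpa [show Even v.length from hv, show Even w.length from hw] using h
      · simp only [not_even_child (N := N) hc.2, if_false, List.dropLast_concat,
          if_pos (show Even v.length from hv)] at h
        exact absurd (h ▸ hc.1) hvK
      · simp only [not_even_child (N := N) hb.2, if_false, List.dropLast_concat,
          if_pos (show Even w.length from hw)] at h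
        exact absurd (h ▸ hb.1) hwK
      · simp only [not_even_child (N := N) hb.2, not_even_child (N := N) hc.2, if_false,
          List.dropLast_concat] at h
        rw [h]
  · intro J hJ hBJ
    obtain ⟨P, hP, hI⟩ := hJ
    have key : ∀ v ∈ J, ∃ p ∈ P, p.first = v := by
      intro v hv; rw [← hI] at hv; exact hv
    have : Nonempty (DiPath InfTreeAdj) := ⟨sing []⟩
    choose! p hpP hpf using key
    have hinj : Set.InjOn (fun v => (p v).last) J := by
      intro v hv w hw h
      have := eq_of_common hP (hpP v hv) (hpP w hw) (last_mem _)
        (by dsimp only at h; rw [h]; exact last_mem _)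
      rw [← hpf v hv, this, hpf w hw]
    have hD : IsDimaze InfTreeAdj InfTreeB0 := fun b hb v => tree_dimaze_out hb
    have hfix : ∀ b ∈ J, b ∈ InfTreeB0 → (p b).last = b := by
      intro b hb hb0
      refine (exit_eq_last hD (p b) hb0 ?_).symm
      have := first_mem (p b)
      rwa [hpf b hb] at this
    have hmaps : Set.MapsTo (fun v => (p v).last) (J \ (InfTreeB0 \ K)) (K ∩ InfTreeB0) := by
      rintro v ⟨hv, hvn⟩
      have h0 := hP.1 _ (hpP v hv)
      refine ⟨?_, h0⟩
      by_contra hnK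
      have hmem : (p v).last ∈ J := hBJ (Or.inl ⟨h0, hnK⟩)
      have := hinj hmem hv (hfix _ hmem h0)
      exact hvn (this ▸ ⟨h0, hnK⟩)
    have hfinK : (K ∩ InfTreeB0).Finite := hK.inter_of_left _
    have hinj' := hinj.mono (Set.diff_subset (s := J) (t := InfTreeB0 \ K))
    have hfinJ : (J \ (InfTreeB0 \ K)).Finite := Set.Finite.of_injOn hmaps hinj' hfinK
    have hle := Set.ncard_le_ncard_of_injOn _ hmaps hinj' hfinK
    have hYc : Y.ncard = (K ∩ InfTreeB0).ncard :=
      Set.ncard_image_of_injective _ (fun a b h => List.append_cancel_right h)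
    have hYJ : Y ⊆ J \ (InfTreeB0 \ K) := fun y hy =>
      ⟨hBJ (Or.inr hy), fun h => hYodd y hy h.1⟩
    have heq : Y = J \ (InfTreeB0 \ K) :=
      Set.eq_of_subset_of_ncard_le hYJ (by rw [hYc]; exact hle) hfinJ
    apply Set.Subset.antisymm _ hBJ
    intro v hv
    by_cases h : v ∈ InfTreeB0 \ K
    · exact Or.inl h
    · right; rw [heq]; exact ⟨hv, h⟩
  · rw [Set.disjoint_left]
    rintro v hv (h | ⟨b, hb, rfl⟩)
    · exact h.2 hv
    · exact hN b hv

end ACProof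

/-- The matroid defined by the countably branching tree dimaze has no finite
circuit and no finite cocircuit; consequently every dimaze defining a strict
gammoid isomorphic to it contains an alternating comb. -/
theorem infTree_forces_AC :
    (¬ ∃ C : Set (List ℕ), C.Finite ∧ IsCircuit (Linkable InfTreeAdj InfTreeB0) C) ∧
    (¬ ∃ K : Set (List ℕ), K.Finite ∧ IsCocircuit (Linkable InfTreeAdj InfTreeB0) K) ∧
    (∀ (V' : Type*) (D' : V' → V' → Prop) (B0' : Set V'),
      IsDimaze D' B0' → IsMatroidIndep (Linkable D' B0') →
      (∃ φ : V' ≃ List ℕ, ∀ I : Set V',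
        Linkable D' B0' I ↔ Linkable InfTreeAdj InfTreeB0 (φ '' I)) →
      ContainsAltComb D' B0') := by
  refine ⟨?_, ?_, ?_⟩
  · rintro ⟨C, hC, hc⟩
    exact hc.1 (ACProof.tree_H1 C hC)
  · rintro ⟨K, hK, hk⟩
    obtain ⟨B, hB, hd⟩ := ACProof.tree_H2 K hK
    obtain ⟨x, hx⟩ := hk.1 B hB
    exact Set.disjoint_left.1 hd hx.1 hx.2
  · intro V' D' B0' hD _ hφ
    obtain ⟨φ, hφ⟩ := hφ
    have H1 : ∀ I : Set V', I.Finite → Linkable D' B0' I := fun I hI =>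
      (hφ I).2 (ACProof.tree_H1 _ (hI.image φ))
    have H2 : ∀ X : Set V', X.Finite →
        ∃ B, MaximalIn (Linkable D' B0') B ∧ Disjoint X B := by
      intro X hX
      obtain ⟨B, hB, hd⟩ := ACProof.tree_H2 _ (hX.image φ)
      have himg : φ '' (φ ⁻¹' B) = B := Set.image_preimage_eq B φ.surjective
      refine ⟨φ ⁻¹' B, ⟨?_, ?_⟩, ?_⟩
      · rw [hφ, himg]; exact hB.1
      · intro J hJ hBJ
        have := hB.2 _ ((hφ J).1 hJ) (by rw [← himg]; exact Set.image_mono hBJ)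
        rw [← this, Set.preimage_image_eq J φ.injective]
      · rw [Set.disjoint_left] at hd ⊢
        intro x hx hx'
        exact hd ⟨x, hx, rfl⟩ hx'
    obtain ⟨P, hP, hI⟩ := H1 {φ.symm []} (Set.finite_singleton _)
    have : φ.symm [] ∈ Ini P := by rw [hI]; rfl
    obtain ⟨p, hp, -⟩ := this
    exact ACProof.comb hD H1 H2 (hP.1 p hp)
end
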